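/- Let V be an irreducible cuspidal Harish-Chandra module over the map full toroidal Lie algebra τ(B). Then V is a single point evaluation module: there exists a maximal ideal 𝔐 of B (equivalently, an algebra homomorphism ψ : B → ℂ) such that (τ ⊗ 𝔐)·V = 0, i.e. (X⊗b)·v = ψ(b)(X⊗1)·v for all X ∈ τ, b ∈ B, v ∈ V. -/

import Mathlib

open scoped TensorProduct

namespace MT

/-- Presentation of the full toroidal Lie algebra `τ` of rank `n` associated with the
finite-dimensional simple complex Lie algebra `𝔤`, the invariant form `κ` and the
2-cocycle `φ = c₁ • φ₁ + c₂ • φ₂`.  Here `E m x` stands for `x ⊗ t^m`, `K m i` for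
`t^m K_i` (the image in the space of Kähler differentials `𝒦 = Ω/dA_n`), and
`W m i` for `t^m d_i`. -/
structure IsFullToroidal (n : ℕ) (𝔤 : Type) [LieRing 𝔤] [LieAlgebra ℂ 𝔤]
    (τ : Type) [LieRing τ] [LieAlgebra ℂ τ]
    (κ : 𝔤 →ₗ[ℂ] 𝔤 →ₗ[ℂ] ℂ) (c₁ c₂ : ℂ)
    (E : (Fin n → ℤ) → 𝔤 →ₗ[ℂ] τ) (K W : (Fin n → ℤ) → Fin n → τ) : Prop where
  κ_symm : ∀ x y, κ x y = κ y x
  κ_invariant : ∀ x y z, κ ⁅x, y⁆ z = κ x ⁅y, z⁆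
  κ_nondeg : ∀ x, (∀ y, κ x y = 0) → x = 0
  span_eq_top : Submodule.span ℂ
      ({z : τ | ∃ m x, z = E m x} ∪ {z : τ | ∃ m i, z = K m i} ∪
        {z : τ | ∃ m i, z = W m i}) = ⊤
  K_rel : ∀ m : Fin n → ℤ, (∑ i, (m i : ℂ) • K m i) = 0
  lie_E_E : ∀ m k x y, ⁅E m x, E k y⁆
      = E (m + k) ⁅x, y⁆ + κ x y • ∑ i, (m i : ℂ) • K (m + k) i
  lie_E_K : ∀ m x k j, ⁅E m x, K k j⁆ = 0
  lie_K_K : ∀ m i k j, ⁅K m i, K k j⁆ = 0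
  lie_W_E : ∀ m i k x, ⁅W m i, E k x⁆ = (k i : ℂ) • E (m + k) x
  lie_W_K : ∀ m i k j, ⁅W m i, K k j⁆
      = (k i : ℂ) • K (m + k) j + (if i = j then ∑ p, (m p : ℂ) • K (m + k) p else 0)
  lie_W_W : ∀ m i k j, ⁅W m i, W k j⁆
      = (k i : ℂ) • W (m + k) j - (m j : ℂ) • W (m + k) i
        + (c₁ * (-((k i : ℂ) * (m j : ℂ))) + c₂ * ((m i : ℂ) * (k j : ℂ)))
          • ∑ p, (m p : ℂ) • K (m + k) p

/-- The map algebra `τ(B) = τ ⊗ B` is a complex Lie algebra. -/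
noncomputable instance mapLieAlgebra (B τ : Type) [CommRing B] [Algebra ℂ B]
    [LieRing τ] [LieAlgebra ℂ τ] : LieAlgebra ℂ (B ⊗[ℂ] τ) :=
  { (inferInstance : Module ℂ (B ⊗[ℂ] τ)) with
    lie_smul := fun c x y => by
      rw [← algebraMap_smul B c y, lie_smul, algebraMap_smul] }

/-- The simultaneous eigenspace ("weight space") of the commuting family of
operators `d` for the eigenvalue function `l`. -/
def weightSpace {n : ℕ} {L V : Type*} [LieRing L] [LieAlgebra ℂ L] [AddCommGroup V]
    [Module ℂ V] [LieRingModule L V] [LieModule ℂ L V]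
    (d : Fin n → L) (l : Fin n → ℂ) : Submodule ℂ V where
  carrier := {v | ∀ i, ⁅d i, v⁆ = l i • v}
  add_mem' := by
    intro a b ha hb i
    rw [lie_add, ha i, hb i, smul_add]
  zero_mem' := by
    intro i
    rw [lie_zero, smul_zero]
  smul_mem' := by
    intro c a ha i
    rw [lie_smul, ha i, smul_comm]

/-- `V` is a Harish-Chandra module with respect to the degree operators `d`:
the sum of the weight spaces is all of `V` and each weight space is finite
dimensional. -/
def IsHarishChandra {n : ℕ} {L V : Type*} [LieRing L] [LieAlgebra ℂ L] [AddCommGroup V]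
    [Module ℂ V] [LieRingModule L V] [LieModule ℂ L V] (d : Fin n → L) : Prop :=
  (⨆ l : Fin n → ℂ, weightSpace (V := V) d l) = ⊤ ∧
    ∀ l : Fin n → ℂ, FiniteDimensional ℂ (weightSpace (V := V) d l)

/-- `V` is cuspidal (uniformly bounded): a Harish-Chandra module whose weight
space dimensions admit a uniform bound. -/
def IsCuspidal {n : ℕ} {L V : Type*} [LieRing L] [LieAlgebra ℂ L] [AddCommGroup V]
    [Module ℂ V] [LieRingModule L V] [LieModule ℂ L V] (d : Fin n → L) : Prop :=
  IsHarishChandra (V := V) d ∧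
    ∃ N : ℕ, ∀ l : Fin n → ℂ, Module.finrank ℂ (weightSpace (V := V) d l) ≤ N

/-- The degree operators `d_i ⊗ 1` inside `τ(B)`. -/
noncomputable def dOp {n : ℕ} (B : Type) [CommRing B] [Algebra ℂ B] {τ : Type}
    [LieRing τ] [LieAlgebra ℂ τ] (W : (Fin n → ℤ) → Fin n → τ) (i : Fin n) :
    B ⊗[ℂ] τ :=
  (1 : B) ⊗ₜ[ℂ] W 0 i

variable {n : ℕ} {𝔤 : Type} [LieRing 𝔤] [LieAlgebra ℂ 𝔤]
variable {τ : Type} [LieRing τ] [LieAlgebra ℂ τ]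

/-- The set of homogeneous generators of `τ` of degree `m`. -/
def genOfDeg (E : (Fin n → ℤ) → 𝔤 →ₗ[ℂ] τ) (K W : (Fin n → ℤ) → Fin n → τ)
    (m : Fin n → ℤ) : Set τ :=
  Set.range (E m) ∪ Set.range (K m) ∪ Set.range (W m)

/-- The homogeneous generators of `τ` of degree lying in the subgroup `M`,
i.e. generators of `τ_M`. -/
def tauMGens (E : (Fin n → ℤ) → 𝔤 →ₗ[ℂ] τ) (K W : (Fin n → ℤ) → Fin n → τ)
    (M : AddSubgroup (Fin n → ℤ)) : Set τ :=
  {Y | ∃ m ∈ M, Y ∈ genOfDeg E K W m}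

/-- The graded piece `τ_m`. -/
def gradedPiece (E : (Fin n → ℤ) → 𝔤 →ₗ[ℂ] τ) (K W : (Fin n → ℤ) → Fin n → τ)
    (m : Fin n → ℤ) : Submodule ℂ τ :=
  Submodule.span ℂ (genOfDeg E K W m)

/-- The subalgebra `τ(B)_M = ⊕_{m ∈ M} τ_m ⊗ B` of `τ(B)`. -/
noncomputable def tauBM (B : Type) [CommRing B] [Algebra ℂ B]
    (E : (Fin n → ℤ) → 𝔤 →ₗ[ℂ] τ) (K W : (Fin n → ℤ) → Fin n → τ)
    (M : AddSubgroup (Fin n → ℤ)) : LieSubalgebra ℂ (B ⊗[ℂ] τ) :=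
  LieSubalgebra.lieSpan ℂ (B ⊗[ℂ] τ)
    {z | ∃ (a : B) (Y : τ), Y ∈ tauMGens E K W M ∧ z = a ⊗ₜ[ℂ] Y}

/-- The degree operators `d_i ⊗ 1` as elements of `τ(B)_M` (note `0 ∈ M`). -/
noncomputable def dOpM (B : Type) [CommRing B] [Algebra ℂ B]
    (E : (Fin n → ℤ) → 𝔤 →ₗ[ℂ] τ) (K W : (Fin n → ℤ) → Fin n → τ)
    (M : AddSubgroup (Fin n → ℤ)) (i : Fin n) : ↥(tauBM B E K W M) :=
  ⟨(1 : B) ⊗ₜ[ℂ] W 0 i,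
    LieSubalgebra.subset_lieSpan
      ⟨1, W 0 i, ⟨0, M.zero_mem, Or.inr ⟨i, rfl⟩⟩, rfl⟩⟩

/-- `(τ ⊗ I)·V = 0`. -/
def annTensor (τ : Type) [LieRing τ] [LieAlgebra ℂ τ] (B : Type) [CommRing B]
    [Algebra ℂ B] (I : Ideal B) (V : Type) [AddCommGroup V] [Module ℂ V]
    [LieRingModule (B ⊗[ℂ] τ) V] : Prop :=
  ∀ X : τ, ∀ a ∈ I, ∀ v : V, ⁅a ⊗ₜ[ℂ] X, v⁆ = 0

/-- The action of `τ(B)` on `V` is by evaluation at the algebra homomorphism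
`ψ : B → ℂ`:  `(X ⊗ b)·v = ψ(b) (X ⊗ 1)·v`. -/
def evalActs (τ : Type) [LieRing τ] [LieAlgebra ℂ τ] (B : Type) [CommRing B]
    [Algebra ℂ B] (ψ : B →ₐ[ℂ] ℂ) (V : Type) [AddCommGroup V] [Module ℂ V]
    [LieRingModule (B ⊗[ℂ] τ) V] : Prop :=
  ∀ (X : τ) (b : B) (v : V), ⁅b ⊗ₜ[ℂ] X, v⁆ = ψ b • ⁅(1 : B) ⊗ₜ[ℂ] X, v⁆

/-- `v` is annihilated by `τ(B)^+_M = ⊕_{m ∈ M, r ≥ 1} τ(B)_{m + rβ}`. -/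
def annPlus (B : Type) [CommRing B] [Algebra ℂ B]
    (E : (Fin n → ℤ) → 𝔤 →ₗ[ℂ] τ) (K W : (Fin n → ℤ) → Fin n → τ)
    (M : AddSubgroup (Fin n → ℤ)) (β : Fin n → ℤ) {V : Type} [AddCommGroup V]
    [Module ℂ V] [LieRingModule (B ⊗[ℂ] τ) V] (v : V) : Prop :=
  ∀ m₀ ∈ M, ∀ r : ℕ, 0 < r → ∀ a : B,
    (∀ x : 𝔤, ⁅a ⊗ₜ[ℂ] E (m₀ + (r : ℤ) • β) x, v⁆ = 0) ∧
    (∀ i : Fin n, ⁅a ⊗ₜ[ℂ] K (m₀ + (r : ℤ) • β) i, v⁆ = 0) ∧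
    (∀ i : Fin n, ⁅a ⊗ₜ[ℂ] W (m₀ + (r : ℤ) • β) i, v⁆ = 0)

/-- Successive action of a list of Lie algebra elements on a module vector:
`actList [x₁, …, x_r] v = x₁ · (x₂ ⋯ (x_r · v))`. -/
def actList {L V : Type*} [LieRing L] [AddCommGroup V] [LieRingModule L V] :
    List L → V → V
  | [], v => v
  | x :: xs, v => ⁅x, actList xs v⁆

/-- `V` is a highest weight module for `τ(B)`:  there are `M ≤ ℤⁿ` and `β ∈ ℤⁿ`
with `ℤⁿ = M ⊕ ℤβ` and a nonzero `v ∈ V` with `τ(B)^+_M · v = 0` which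
generates `V` over `U(τ(B))`. -/
def IsHighestWeightModule (B : Type) [CommRing B] [Algebra ℂ B]
    (E : (Fin n → ℤ) → 𝔤 →ₗ[ℂ] τ) (K W : (Fin n → ℤ) → Fin n → τ)
    (V : Type) [AddCommGroup V] [Module ℂ V] [LieRingModule (B ⊗[ℂ] τ) V]
    [LieModule ℂ (B ⊗[ℂ] τ) V] : Prop :=
  ∃ (M : AddSubgroup (Fin n → ℤ)) (β : Fin n → ℤ),
    IsCompl M (AddSubgroup.zmultiples β) ∧
    ∃ v : V, v ≠ 0 ∧ annPlus B E K W M β v ∧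
      LieSubmodule.lieSpan ℂ (B ⊗[ℂ] τ) {v} = ⊤

/-- Linear independence properties of the generators of the full toroidal Lie
algebra: the only linear relations among the homogeneous generators are the
Kähler relations `∑ᵢ mᵢ t^m K_i = 0`. -/
structure FreeGens (E : (Fin n → ℤ) → 𝔤 →ₗ[ℂ] τ) (K W : (Fin n → ℤ) → Fin n → τ) :
    Prop where
  K_indep : ∀ (m : Fin n → ℤ) (c : Fin n → ℂ), (∑ i, c i • K m i) = 0 →
      ∃ t : ℂ, ∀ i, c i = t * (m i : ℂ)
  W_indep : ∀ (m : Fin n → ℤ) (c : Fin n → ℂ), (∑ i, c i • W m i) = 0 → ∀ i, c i = 0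
  E_inj : ∀ (m : Fin n → ℤ) (x : 𝔤), E m x = 0 → x = 0
  EKW_indep : ∀ (m : Fin n → ℤ) (x : 𝔤) (c d : Fin n → ℂ),
      E m x + (∑ i, c i • K m i) + (∑ i, d i • W m i) = 0 →
      x = 0 ∧ (∀ i, d i = 0) ∧ ∃ t : ℂ, ∀ i, c i = t * (m i : ℂ)
  graded_indep : ∀ m : Fin n → ℤ,
      gradedPiece E K W m ⊓ (⨆ k : Fin n → ℤ, ⨆ _ : k ≠ m, gradedPiece E K W k) = ⊥

/-- The linear extension `u ↦ ∑ i, u i • F m i` of a family of homogeneous generators. -/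
noncomputable def vec (F : (Fin n → ℤ) → Fin n → τ) (m : Fin n → ℤ) (u : Fin n → ℂ) : τ :=
  ∑ i, u i • F m i

/-- The pairing of a complex vector with an integral one. -/
noncomputable def pair (u : Fin n → ℂ) (k : Fin n → ℤ) : ℂ := ∑ i, u i * (k i : ℂ)

lemma pair_add (u : Fin n → ℂ) (k l : Fin n → ℤ) : pair u (k + l) = pair u k + pair u l := by
  simp [pair, mul_add, Finset.sum_add_distrib]

lemma pair_sub (u : Fin n → ℂ) (k l : Fin n → ℤ) : pair u (k - l) = pair u k - pair u l := by
  simp [pair, mul_sub, Finset.sum_sub_distrib]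

/-- A complex vector which pairs nontrivially with every nonzero integral vector. -/
def IsGeneric (u : Fin n → ℂ) : Prop := ∀ m : Fin n → ℤ, m ≠ 0 → pair u m ≠ 0

lemma exists_isGeneric (n : ℕ) : ∃ u : Fin n → ℂ, IsGeneric u := by
  obtain ⟨x, hx⟩ : ∃ x : ℂ, Transcendental ℤ x := by
    refine ⟨((liouvilleNumber 2 : ℝ) : ℂ), ?_⟩
    have h := transcendental_liouvilleNumber (m := 2) le_rfl
    have := (transcendental_algebraMap_iff (R := ℤ) (S := ℝ) (A := ℂ)
      (FaithfulSMul.algebraMap_injective ℝ ℂ)).mpr h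
    simpa using this
  refine ⟨fun i => x ^ (i : ℕ), fun m hm h => hm ?_⟩
  have h0 : (∑ i : Fin n, Polynomial.C (m i) * Polynomial.X ^ (i : ℕ)) = 0 := by
    by_contra hne
    refine hx ⟨_, hne, ?_⟩
    simpa [pair, mul_comm] using h
  ext j
  have := congrArg (fun p => Polynomial.coeff p (j : ℕ)) h0
  simpa [Polynomial.finsetSum_coeff, Polynomial.coeff_C_mul, Polynomial.coeff_X_pow,
    Fin.val_inj] using this

section Toroidal

variable {κ : 𝔤 →ₗ[ℂ] 𝔤 →ₗ[ℂ] ℂ} {c₁ c₂ : ℂ}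
  {E : (Fin n → ℤ) → 𝔤 →ₗ[ℂ] τ} {K W : (Fin n → ℤ) → Fin n → τ}

lemma E_mem_gradedPiece (m : Fin n → ℤ) (x : 𝔤) : E m x ∈ gradedPiece E K W m :=
  Submodule.subset_span (Or.inl (Or.inl ⟨x, rfl⟩))

lemma K_mem_gradedPiece (m : Fin n → ℤ) (i : Fin n) : K m i ∈ gradedPiece E K W m :=
  Submodule.subset_span (Or.inl (Or.inr ⟨i, rfl⟩))

lemma W_mem_gradedPiece (m : Fin n → ℤ) (i : Fin n) : W m i ∈ gradedPiece E K W m :=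
  Submodule.subset_span (Or.inr ⟨i, rfl⟩)

lemma vec_W_mem_gradedPiece (m : Fin n → ℤ) (u : Fin n → ℂ) :
    vec W m u ∈ gradedPiece E K W m :=
  Submodule.sum_mem _ fun i _ => Submodule.smul_mem _ _ (W_mem_gradedPiece m i)

lemma gradedPiece_le_iff {m : Fin n → ℤ} {S : Submodule ℂ τ} :
    gradedPiece E K W m ≤ S ↔
      (∀ x, E m x ∈ S) ∧ (∀ i, K m i ∈ S) ∧ ∀ i, W m i ∈ S := by
  constructor
  · intro h
    exact ⟨fun x => h (E_mem_gradedPiece m x), fun i => h (K_mem_gradedPiece m i),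
      fun i => h (W_mem_gradedPiece m i)⟩
  · rintro ⟨h1, h2, h3⟩
    refine Submodule.span_le.mpr ?_
    rintro _ ((⟨x, rfl⟩ | ⟨i, rfl⟩) | ⟨i, rfl⟩)
    exacts [h1 x, h2 i, h3 i]

lemma finite_gradedPiece [FiniteDimensional ℂ 𝔤] (m : Fin n → ℤ) :
    Module.Finite ℂ (gradedPiece E K W m) := by
  have h : gradedPiece E K W m =
      LinearMap.range (E m) ⊔ Submodule.span ℂ (Set.range (K m) ∪ Set.range (W m)) := by
    rw [gradedPiece, genOfDeg, Set.union_assoc, Submodule.span_union]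
    congr 1
    rw [← LinearMap.coe_range, Submodule.span_eq]
  have : FiniteDimensional ℂ (Submodule.span ℂ (Set.range (K m) ∪ Set.range (W m))) :=
    FiniteDimensional.span_of_finite ℂ ((Set.finite_range _).union (Set.finite_range _))
  rw [h]
  infer_instance

namespace IsFullToroidal

lemma iSup_gradedPiece (hτ : IsFullToroidal n 𝔤 τ κ c₁ c₂ E K W) :
    (⨆ m, gradedPiece E K W m) = ⊤ := by
  rw [eq_top_iff, ← hτ.span_eq_top, Submodule.span_le]
  rintro _ ((⟨m, x, rfl⟩ | ⟨m, x, rfl⟩) | ⟨m, x, rfl⟩)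
  · exact Submodule.mem_iSup_of_mem m (E_mem_gradedPiece m x)
  · exact Submodule.mem_iSup_of_mem m (K_mem_gradedPiece m x)
  · exact Submodule.mem_iSup_of_mem m (W_mem_gradedPiece m x)

lemma eq_top_of_gradedPiece_le (hτ : IsFullToroidal n 𝔤 τ κ c₁ c₂ E K W)
    {S : Submodule ℂ τ} (h : ∀ m, gradedPiece E K W m ≤ S) (Y : τ) :
    Y ∈ S :=
  (hτ.iSup_gradedPiece ▸ iSup_le h : (⊤ : Submodule ℂ τ) ≤ S) trivial

lemma lie_degree (hτ : IsFullToroidal n 𝔤 τ κ c₁ c₂ E K W)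
    {m : Fin n → ℤ} (i : Fin n) {Y : τ} (hY : Y ∈ gradedPiece E K W m) :
    ⁅W 0 i, Y⁆ = (m i : ℂ) • Y := by
  induction hY using Submodule.span_induction with
  | mem Y h =>
    rcases h with (⟨x, rfl⟩ | ⟨j, rfl⟩) | ⟨j, rfl⟩
    · rw [hτ.lie_W_E, zero_add]
    · rw [hτ.lie_W_K]; simp
    · rw [hτ.lie_W_W]; simp
  | zero => simp
  | add x y _ _ hx hy => rw [lie_add, hx, hy, smul_add]
  | smul a x _ hx => rw [lie_smul, hx, smul_comm]

lemma lie_vec_zero (hτ : IsFullToroidal n 𝔤 τ κ c₁ c₂ E K W)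
    {m : Fin n → ℤ} (u : Fin n → ℂ) {Y : τ} (hY : Y ∈ gradedPiece E K W m) :
    ⁅vec W 0 u, Y⁆ = pair u m • Y := by
  simp only [vec, sum_lie, smul_lie, hτ.lie_degree _ hY, pair, Finset.sum_smul, mul_smul]

lemma lie_vec_E (hτ : IsFullToroidal n 𝔤 τ κ c₁ c₂ E K W)
    (m k : Fin n → ℤ) (u : Fin n → ℂ) (x : 𝔤) :
    ⁅vec W m u, E k x⁆ = pair u k • E (m + k) x := by
  simp only [vec, sum_lie, smul_lie, hτ.lie_W_E, pair, Finset.sum_smul, mul_smul]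

lemma lie_vec_K (hτ : IsFullToroidal n 𝔤 τ κ c₁ c₂ E K W)
    (m k : Fin n → ℤ) (u : Fin n → ℂ) (j : Fin n) :
    ⁅vec W m u, K k j⁆ =
      pair u k • K (m + k) j + u j • vec K (m + k) (fun p => (m p : ℂ)) := by
  simp only [vec, sum_lie, smul_lie, hτ.lie_W_K, pair, Finset.sum_smul, mul_smul, smul_add,
    Finset.sum_add_distrib, smul_ite, smul_zero, Finset.sum_ite_eq', Finset.mem_univ, if_true]

lemma lie_vec_W (hτ : IsFullToroidal n 𝔤 τ κ c₁ c₂ E K W)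
    (m k : Fin n → ℤ) (u : Fin n → ℂ) (j : Fin n) :
    ∃ a : ℂ, ⁅vec W m u, W k j⁆ =
      pair u k • W (m + k) j - (m j : ℂ) • vec W (m + k) u
        + a • vec K (m + k) (fun p => (m p : ℂ)) := by
  refine ⟨∑ i, u i * (c₁ * (-((k i : ℂ) * (m j : ℂ))) + c₂ * ((m i : ℂ) * (k j : ℂ))), ?_⟩
  rw [Finset.sum_smul]
  conv_lhs => rw [vec, sum_lie]
  simp only [smul_lie, hτ.lie_W_W]
  simp only [smul_add, smul_sub, Finset.sum_add_distrib, Finset.sum_sub_distrib, pair,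
    Finset.sum_smul, mul_smul]
  simp only [vec, Finset.smul_sum (s := Finset.univ) (r := ((m j : ℤ) : ℂ))]
  congr 2
  refine Finset.sum_congr rfl fun i _ => ?_
  rw [smul_comm]

/-- Bracketing `τ_k` with a generic `vec W m u` yields all of `τ_{m+k}`, up to a central term. -/
lemma gradedPiece_le_of_lie_vec (hτ : IsFullToroidal n 𝔤 τ κ c₁ c₂ E K W)
    {u : Fin n → ℂ} (hu : IsGeneric u) {m k : Fin n → ℤ}
    (hk : k ≠ 0) (hkm : k ≠ m) {S : Submodule ℂ τ}
    (hS : ∀ Y ∈ gradedPiece E K W k, ⁅vec W m u, Y⁆ ∈ S)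
    (hc : vec K (m + k) (fun p => (m p : ℂ)) ∈ S) : gradedPiece E K W (m + k) ≤ S := by
  have hk' := hu k hk
  have hkm' : pair u k - pair u m ≠ 0 := by
    rw [← pair_sub]; exact hu _ (sub_ne_zero.mpr hkm)
  have hW : ∀ j, pair u k • W (m + k) j - (m j : ℂ) • vec W (m + k) u ∈ S := by
    intro j
    obtain ⟨a, ha⟩ := hτ.lie_vec_W m k u j
    have h := hS _ (W_mem_gradedPiece k j)
    rw [ha] at h
    exact (Submodule.add_mem_iff_left _ (S.smul_mem _ hc)).mp h
  have hWu : vec W (m + k) u ∈ S := by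
    have h : ∑ j, u j • (pair u k • W (m + k) j - (m j : ℂ) • vec W (m + k) u) ∈ S :=
      Submodule.sum_mem _ fun j _ => S.smul_mem _ (hW j)
    have h2 : ∑ j, u j • (pair u k • W (m + k) j - (m j : ℂ) • vec W (m + k) u) =
        (pair u k - pair u m) • vec W (m + k) u := by
      simp only [smul_sub, Finset.sum_sub_distrib, sub_smul]
      congr 1
      · rw [vec, Finset.smul_sum]
        exact Finset.sum_congr rfl fun j _ => smul_comm _ _ _
      · simp only [pair, Finset.sum_smul, mul_smul]
    rw [h2] at h
    exact (Submodule.smul_mem_iff _ hkm').mp h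
  refine gradedPiece_le_iff.mpr ⟨fun x => ?_, fun j => ?_, fun j => ?_⟩
  · have h := hS _ (E_mem_gradedPiece k x)
    rw [hτ.lie_vec_E] at h
    exact (Submodule.smul_mem_iff _ hk').mp h
  · have h := hS _ (K_mem_gradedPiece k j)
    rw [hτ.lie_vec_K] at h
    exact (Submodule.smul_mem_iff _ hk').mp
      ((Submodule.add_mem_iff_left _ (S.smul_mem _ hc)).mp h)
  · exact (Submodule.smul_mem_iff _ hk').mp
      ((Submodule.sub_mem_iff_left _ (S.smul_mem _ hWu)).mp (hW j))

lemma gradedPiece_le_of_lie_vec' (hτ : IsFullToroidal n 𝔤 τ κ c₁ c₂ E K W)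
    {u : Fin n → ℂ} (hu : IsGeneric u) {m k : Fin n → ℤ}
    (hk : k ≠ 0) (hkm : k ≠ m) (hmk : m + k ≠ 0) {S : Submodule ℂ τ}
    (hS : ∀ Y ∈ gradedPiece E K W k, ⁅vec W m u, Y⁆ ∈ S) :
    gradedPiece E K W (m + k) ≤ S := by
  refine hτ.gradedPiece_le_of_lie_vec hu hk hkm hS ?_
  have h : ∑ j, (m j : ℂ) • ⁅vec W m u, K k j⁆ ∈ S :=
    Submodule.sum_mem _ fun j _ => S.smul_mem _ (hS _ (K_mem_gradedPiece k j))
  have h2 : ∑ j, (m j : ℂ) • ⁅vec W m u, K k j⁆ =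
      pair u (m + k) • vec K (m + k) (fun p => (m p : ℂ)) := by
    simp only [hτ.lie_vec_K, smul_add, Finset.sum_add_distrib, pair_add, add_smul]
    rw [add_comm]
    congr 1
    · simp only [pair, Finset.sum_smul, smul_smul, mul_comm]
    · conv_rhs => rw [vec, Finset.smul_sum]
      exact Finset.sum_congr rfl fun j _ => smul_comm _ _ _
  rw [h2] at h
  exact (Submodule.smul_mem_iff _ (hu _ hmk)).mp h

lemma gradedPiece_le_of_lie (hτ : IsFullToroidal n 𝔤 τ κ c₁ c₂ E K W)
    (hn : 2 ≤ n) {m k : Fin n → ℤ} (hk : k ≠ 0) (hkm : k ≠ m)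
    {S : Submodule ℂ τ}
    (hS : ∀ Y ∈ gradedPiece E K W m, ∀ Z ∈ gradedPiece E K W k, ⁅Y, Z⁆ ∈ S) :
    gradedPiece E K W (m + k) ≤ S := by
  obtain ⟨u, hu⟩ := exists_isGeneric n
  refine hτ.gradedPiece_le_of_lie_vec hu hk hkm
    (fun Y hY => hS _ (vec_W_mem_gradedPiece m u) Y hY) ?_
  obtain ⟨w, j, hwj, hwk⟩ : ∃ (w : Fin n → ℂ) (j : Fin n), w j ≠ 0 ∧ pair w k = 0 := by
    by_cases hz : ∃ i, k i = 0
    · obtain ⟨i, hi⟩ := hz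
      exact ⟨Pi.single i 1, i, by simp, by simp [pair, Pi.single_apply, hi]⟩
    · push Not at hz
      let i : Fin n := ⟨0, by omega⟩
      let j : Fin n := ⟨1, by omega⟩
      have hij : i ≠ j := by simp [i, j]
      refine ⟨Pi.single j (k i : ℂ) - Pi.single i (k j : ℂ), j, ?_, ?_⟩
      · simp [hij.symm, hz i]
      · simp [pair, Pi.single_apply, mul_sub, Finset.sum_sub_distrib, mul_comm]
  have h := hS _ (vec_W_mem_gradedPiece m w) _ (K_mem_gradedPiece k j)
  rw [hτ.lie_vec_K, hwk, zero_smul, zero_add] at h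
  exact (Submodule.smul_mem_iff _ hwj).mp h

end IsFullToroidal

end Toroidal

section Representation

variable {B : Type} [CommRing B] [Algebra ℂ B] {V : Type} [AddCommGroup V] [Module ℂ V]

/-- The simultaneous eigenspace of the degree operators acting through `ρ`. -/
def wt (ρ : B →ₗ[ℂ] τ →ₗ[ℂ] Module.End ℂ V) (W : (Fin n → ℤ) → Fin n → τ) (l : Fin n → ℂ) :
    Submodule ℂ V where
  carrier := {v | ∀ i, ρ 1 (W 0 i) v = l i • v}
  add_mem' := fun ha hb i => by rw [map_add, ha i, hb i, smul_add]
  zero_mem' := fun i => by rw [map_zero, smul_zero]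
  smul_mem' := fun c a ha i => by rw [map_smul, ha i, smul_comm]

/-- An irreducible cuspidal representation of `B ⊗ τ`, written as a bilinear action `ρ`, all of
whose weight spaces have dimension at most `N`. -/
structure IsCuspidalRep (ρ : B →ₗ[ℂ] τ →ₗ[ℂ] Module.End ℂ V)
    (W : (Fin n → ℤ) → Fin n → τ) (N : ℕ) : Prop where
  apply_apply : ∀ a b X Y v, ρ a X (ρ b Y v) = ρ b Y (ρ a X v) + ρ (a * b) ⁅X, Y⁆ v
  nontrivial : Nontrivial V
  eq_bot_or_eq_top : ∀ U : Submodule ℂ V, (∀ b X, ∀ v ∈ U, ρ b X v ∈ U) → U = ⊥ ∨ U = ⊤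
  iSup_wt : (⨆ l, wt ρ W l) = ⊤
  finite_wt : ∀ l, FiniteDimensional ℂ (wt ρ W l)
  finrank_wt_le : ∀ l, Module.finrank ℂ (wt ρ W l) ≤ N

/-- The largest ideal `A` of `B` such that `τ ⊗ A` acts by zero. -/
def annIdeal (ρ : B →ₗ[ℂ] τ →ₗ[ℂ] Module.End ℂ V) : Ideal B where
  carrier := {b | ∀ c X, ρ (c * b) X = 0}
  add_mem' := fun ha hb c X => by
    rw [mul_add, map_add, LinearMap.add_apply, ha, hb, add_zero]
  zero_mem' := fun c X => by simp
  smul_mem' := fun a b hb c X => by rw [smul_eq_mul, ← mul_assoc]; exact hb _ _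

/-- The largest ideal `I` of `B` such that `S ⊗ I` kills the submodule `U`. -/
def annOn (ρ : B →ₗ[ℂ] τ →ₗ[ℂ] Module.End ℂ V) (U : Submodule ℂ V) (S : Submodule ℂ τ) :
    Ideal B where
  carrier := {b | ∀ c, ∀ Y ∈ S, ∀ v ∈ U, ρ (c * b) Y v = 0}
  add_mem' := fun ha hb c Y hY v hv => by
    rw [mul_add, map_add, LinearMap.add_apply, LinearMap.add_apply, ha c Y hY v hv,
      hb c Y hY v hv, add_zero]
  zero_mem' := fun c X => by simp
  smul_mem' := fun a b hb c X => by rw [smul_eq_mul, ← mul_assoc]; exact hb _ _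

/-- The vectors killed by `τ ⊗ I`. -/
def killedBy (ρ : B →ₗ[ℂ] τ →ₗ[ℂ] Module.End ℂ V) (I : Ideal B) : Submodule ℂ V where
  carrier := {v | ∀ b ∈ I, ∀ X, ρ b X v = 0}
  add_mem' := fun ha hb b h X => by rw [map_add, ha b h X, hb b h X, add_zero]
  zero_mem' := fun b _ X => map_zero _
  smul_mem' := fun c a ha b h X => by rw [map_smul, ha b h X, smul_zero]

/-- In a finite-dimensional quotient, nilpotency of an ideal is bounded by the dimension. -/
lemma pow_le_of_finrank_quotient_le {I J : Ideal B} {c D : ℕ} (hc : I ^ c ≤ J)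
    [Module.Finite ℂ (B ⧸ J)] (hD : Module.finrank ℂ (B ⧸ J) ≤ D) : I ^ D ≤ J := by
  set I' : Ideal (B ⧸ J) := I.map (Ideal.Quotient.mk J) with hI'
  have hnil : I' ^ c = ⊥ := by
    rw [hI', ← Ideal.map_pow, eq_bot_iff, Ideal.map_le_iff_le_comap]
    intro x hx
    simpa [Ideal.mem_comap, Ideal.Quotient.eq_zero_iff_mem] using hc hx
  have key : ∀ k, I' ^ k = ⊥ ∨
      Module.finrank ℂ ((I' ^ k).restrictScalars ℂ) + k ≤ D := by
    intro k
    induction k with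
    | zero => exact Or.inr ((Submodule.finrank_le _).trans hD)
    | succ k ih =>
      by_cases h1 : I' ^ (k + 1) = ⊥
      · exact Or.inl h1
      right
      rcases ih with h0 | h0
      · exact absurd (by rw [pow_succ, h0, Ideal.bot_mul]) h1
      have hlt : (I' ^ (k + 1)).restrictScalars ℂ < (I' ^ k).restrictScalars ℂ := by
        refine lt_of_le_of_ne (Ideal.pow_le_pow_right (Nat.le_succ k)) fun heq => h1 ?_
        have heq' : I' ^ (k + 1) = I' ^ k := Submodule.restrictScalars_injective ℂ _ _ heq
        have hst : ∀ j, I' ^ (k + j) = I' ^ k := by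
          intro j
          induction j with
          | zero => rfl
          | succ j ihj => rw [← add_assoc, pow_succ, ihj, ← pow_succ, heq']
        rw [heq', ← hst c, pow_add, hnil, Ideal.mul_bot]
      have := Submodule.finrank_lt_finrank_of_lt hlt
      omega
  have hbot : I' ^ D = ⊥ := by
    rcases key D with h | h
    · exact h
    · have h0 : Module.finrank ℂ ((I' ^ D).restrictScalars ℂ) = 0 := by omega
      rw [Submodule.finrank_eq_zero] at h0
      exact (Submodule.restrictScalars_eq_bot_iff _ _ _).mp h0
  intro x hx
  have : Ideal.Quotient.mk J x ∈ I' ^ D := by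
    rw [hI', ← Ideal.map_pow]; exact Ideal.mem_map_of_mem _ hx
  rw [hbot] at this
  exact Ideal.Quotient.eq_zero_iff_mem.mp this

/-- The action of `S ⊗ B` as a map from a subspace `U` to a subspace `U'`. -/
noncomputable def restrictAction (ρ : B →ₗ[ℂ] τ →ₗ[ℂ] Module.End ℂ V) {U U' : Submodule ℂ V}
    {S : Submodule ℂ τ} (h : ∀ (b : B) (Y : S), ∀ v ∈ U, ρ b Y v ∈ U') :
    B →ₗ[ℂ] S →ₗ[ℂ] U →ₗ[ℂ] U' :=
  LinearMap.mk₂ ℂ (fun b Y => (ρ b Y).restrict (h b Y))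
    (fun a b Y => LinearMap.ext fun v => Subtype.ext (by
      change ρ (a + b) Y v = ρ a Y v + ρ b Y v
      rw [map_add]; rfl))
    (fun c b Y => LinearMap.ext fun v => Subtype.ext (by
      change ρ (c • b) Y v = c • ρ b Y v
      rw [map_smul]; rfl))
    (fun b Y Z => LinearMap.ext fun v => Subtype.ext (by
      change ρ b ((Y : τ) + Z) v = ρ b Y v + ρ b Z v
      rw [map_add]; rfl))
    (fun c b Y => LinearMap.ext fun v => Subtype.ext (by
      change ρ b (c • (Y : τ)) v = c • ρ b Y v
      rw [map_smul]; rfl))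

lemma mem_ker_restrictAction (ρ : B →ₗ[ℂ] τ →ₗ[ℂ] Module.End ℂ V) {U U' : Submodule ℂ V}
    {S : Submodule ℂ τ} (h : ∀ (b : B) (Y : S), ∀ v ∈ U, ρ b Y v ∈ U') (b : B) :
    b ∈ LinearMap.ker (restrictAction ρ h) ↔ ∀ Y ∈ S, ∀ v ∈ U, ρ b Y v = 0 := by
  rw [LinearMap.mem_ker]
  constructor
  · intro h0 Y hY v hv
    exact congrArg Subtype.val (LinearMap.congr_fun (LinearMap.congr_fun h0 ⟨Y, hY⟩) ⟨v, hv⟩)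
  · intro h0
    exact LinearMap.ext fun Y => LinearMap.ext fun v => Subtype.ext (h0 Y Y.2 v v.2)

lemma finite_quotient_of_ker_eq {M : Type*} [AddCommGroup M] [Module ℂ M]
    [FiniteDimensional ℂ M] {f : B →ₗ[ℂ] M} {J : Ideal B}
    (h : LinearMap.ker f = J.restrictScalars ℂ) :
    Module.Finite ℂ (B ⧸ J) ∧ Module.finrank ℂ (B ⧸ J) ≤ Module.finrank ℂ M := by
  let e : (B ⧸ J) ≃ₗ[ℂ] LinearMap.range f :=
    (Submodule.Quotient.restrictScalarsEquiv ℂ J).symm.trans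
      ((Submodule.quotEquivOfEq _ _ h.symm).trans f.quotKerEquivRange)
  refine ⟨Module.Finite.equiv e.symm, ?_⟩
  rw [e.finrank_eq]
  exact Submodule.finrank_le _

variable {κ : 𝔤 →ₗ[ℂ] 𝔤 →ₗ[ℂ] ℂ} {c₁ c₂ : ℂ}
  {E : (Fin n → ℤ) → 𝔤 →ₗ[ℂ] τ} {K W : (Fin n → ℤ) → Fin n → τ}
  {ρ : B →ₗ[ℂ] τ →ₗ[ℂ] Module.End ℂ V} {N : ℕ}

namespace IsCuspidalRep

lemma eq_top_of_mem (hρ : IsCuspidalRep ρ W N)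
    {U : Submodule ℂ V} (hU : ∀ b X, ∀ v ∈ U, ρ b X v ∈ U) {v : V}
    (hv : v ∈ U) (hv0 : v ≠ 0) : U = ⊤ := by
  rcases hρ.eq_bot_or_eq_top U hU with h | h
  · rw [h] at hv; exact absurd ((Submodule.mem_bot ℂ).mp hv) hv0
  · exact h

lemma exists_wt_ne_bot (hρ : IsCuspidalRep ρ W N) : ∃ l, wt ρ W l ≠ ⊥ := by
  by_contra! h
  have := hρ.iSup_wt
  simp only [h, iSup_bot] at this
  have := hρ.nontrivial
  exact bot_ne_top ‹(⊥ : Submodule ℂ V) = ⊤›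

lemma killedBy_stable (hρ : IsCuspidalRep ρ W N)
    (I : Ideal B) (b : B) (X : τ) (v : V) (hv : v ∈ killedBy ρ I) :
    ρ b X v ∈ killedBy ρ I := by
  intro a ha Y
  rw [hρ.apply_apply, hv a ha Y, map_zero, hv _ (I.mul_mem_right b ha), add_zero]

lemma le_annIdeal_of_mem_killedBy (hρ : IsCuspidalRep ρ W N)
    {I : Ideal B} {v : V} (hv : v ∈ killedBy ρ I) (hv0 : v ≠ 0) :
    I ≤ annIdeal ρ := by
  intro b hb c X
  have htop := hρ.eq_top_of_mem (hρ.killedBy_stable I) hv hv0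
  ext w
  have hw : w ∈ killedBy ρ I := htop ▸ trivial
  exact hw _ (I.mul_mem_left c hb) X

lemma degree_apply (hρ : IsCuspidalRep ρ W N)
    (hτ : IsFullToroidal n 𝔤 τ κ c₁ c₂ E K W) {m : Fin n → ℤ} {Y : τ}
    (hY : Y ∈ gradedPiece E K W m) (i : Fin n) (a b : B) (v : V) :
    ρ a (W 0 i) (ρ b Y v) = ρ b Y (ρ a (W 0 i) v) + (m i : ℂ) • ρ (a * b) Y v := by
  rw [hρ.apply_apply, hτ.lie_degree i hY, map_smul, LinearMap.smul_apply]

lemma apply_mem_wt (hρ : IsCuspidalRep ρ W N)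
    (hτ : IsFullToroidal n 𝔤 τ κ c₁ c₂ E K W) {m : Fin n → ℤ} {Y : τ}
    (hY : Y ∈ gradedPiece E K W m) (b : B) {l : Fin n → ℂ} {v : V} (hv : v ∈ wt ρ W l) :
    ρ b Y v ∈ wt ρ W (l + fun i => (m i : ℂ)) := by
  intro i
  rw [hρ.degree_apply hτ hY, hv i, map_smul, one_mul, Pi.add_apply, add_smul]

lemma apply_mem_wt_self (hρ : IsCuspidalRep ρ W N) (hτ : IsFullToroidal n 𝔤 τ κ c₁ c₂ E K W) {Y : τ}
    (hY : Y ∈ gradedPiece E K W 0) (b : B) {l : Fin n → ℂ} {v : V} (hv : v ∈ wt ρ W l) :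
    ρ b Y v ∈ wt ρ W l := by
  have := hρ.apply_mem_wt hτ hY b hv
  have h0 : (fun i => (((0 : Fin n → ℤ) i : ℤ) : ℂ)) = 0 := by ext; simp
  rwa [h0, add_zero] at this

lemma mem_annOn_iff (hρ : IsCuspidalRep ρ W N)
    (hτ : IsFullToroidal n 𝔤 τ κ c₁ c₂ E K W) {m : Fin n → ℤ} (hm : m ≠ 0)
    {S : Submodule ℂ τ} (hS : S ≤ gradedPiece E K W m) (l : Fin n → ℂ) (b : B) :
    b ∈ annOn ρ (wt ρ W l) S ↔ ∀ Y ∈ S, ∀ v ∈ wt ρ W l, ρ b Y v = 0 := by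
  constructor
  · intro h Y hY v hv
    simpa using h 1 Y hY v hv
  · intro h c Y hY v hv
    obtain ⟨i, hi⟩ := Function.ne_iff.mp hm
    have hW : W 0 i ∈ gradedPiece E K W 0 := W_mem_gradedPiece 0 i
    have h1 := hρ.degree_apply hτ (hS hY) i c b v
    rw [h Y hY v hv, map_zero, h Y hY _ (hρ.apply_mem_wt_self hτ hW c hv), zero_add] at h1
    exact (smul_eq_zero.mp h1.symm).resolve_left (by exact_mod_cast hi)

lemma finite_quotient_annOn (hρ : IsCuspidalRep ρ W N)
    (hτ : IsFullToroidal n 𝔤 τ κ c₁ c₂ E K W) {m : Fin n → ℤ}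
    (hm : m ≠ 0) {S : Submodule ℂ τ} [FiniteDimensional ℂ S]
    (hS : S ≤ gradedPiece E K W m) (l : Fin n → ℂ) :
    Module.Finite ℂ (B ⧸ annOn ρ (wt ρ W l) S) ∧
      Module.finrank ℂ (B ⧸ annOn ρ (wt ρ W l) S) ≤ Module.finrank ℂ S * (N * N) := by
  have h1 := hρ.finite_wt l
  have h2 := hρ.finite_wt (l + fun i => (m i : ℂ))
  have hmap : ∀ (b : B) (Y : S), ∀ v ∈ wt ρ W l, ρ b Y v ∈ wt ρ W (l + fun i => (m i : ℂ)) :=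
    fun b Y v hv => hρ.apply_mem_wt hτ (hS Y.2) b hv
  have hker : LinearMap.ker (restrictAction ρ hmap) =
      (annOn ρ (wt ρ W l) S).restrictScalars ℂ := by
    ext b
    rw [mem_ker_restrictAction, Submodule.restrictScalars_mem, hρ.mem_annOn_iff hτ hm hS]
  have h3 := finite_quotient_of_ker_eq
    (M := S →ₗ[ℂ] wt ρ W l →ₗ[ℂ] wt ρ W (l + fun i => (m i : ℂ))) hker
  refine ⟨h3.1, h3.2.trans ?_⟩
  rw [Module.finrank_linearMap, Module.finrank_linearMap]
  exact Nat.mul_le_mul_left _ (Nat.mul_le_mul (hρ.finrank_wt_le _) (hρ.finrank_wt_le _))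

end IsCuspidalRep

end Representation

/-- An induction principle for `ℤⁿ`. -/
lemma forall_of_add_single {P : (Fin n → ℤ) → Prop} (h0 : P 0)
    (hadd : ∀ l i, P l → P (l + Pi.single i 1) ∧ P (l + Pi.single i (-1))) (l : Fin n → ℤ) :
    P l := by
  have h1 : ∀ (z : ℤ) (i : Fin n) (l : Fin n → ℤ), P l → P (l + Pi.single i z) := by
    intro z i l hl
    induction z using Int.induction_on with
    | zero => simpa using hl
    | succ k ih => rw [Pi.single_add, ← add_assoc]; exact (hadd _ i ih).1
    | pred k ih => rw [sub_eq_add_neg, Pi.single_add, ← add_assoc]; exact (hadd _ i ih).2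
  have h2 : ∀ s : Finset (Fin n), P (∑ i ∈ s, Pi.single i (l i)) := by
    intro s
    induction s using Finset.induction_on with
    | empty => simpa using h0
    | insert i s hi ih => rw [Finset.sum_insert hi, add_comm]; exact h1 _ _ _ ih
  simpa [Finset.univ_sum_single] using h2 Finset.univ

section Cofinite

variable {B : Type} [CommRing B] [Algebra ℂ B] {V : Type} [AddCommGroup V] [Module ℂ V]
variable {κ : 𝔤 →ₗ[ℂ] 𝔤 →ₗ[ℂ] ℂ} {c₁ c₂ : ℂ}
  {E : (Fin n → ℤ) → 𝔤 →ₗ[ℂ] τ} {K W : (Fin n → ℤ) → Fin n → τ}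
  {ρ : B →ₗ[ℂ] τ →ₗ[ℂ] Module.End ℂ V} {N : ℕ}

lemma apply_eq_zero_of_mem_annOn {U : Submodule ℂ V} {S : Submodule ℂ τ} {b : B}
    (hb : b ∈ annOn ρ U S) {Y : τ} (hY : Y ∈ S) {v : V} (hv : v ∈ U) : ρ b Y v = 0 := by
  simpa using hb 1 Y hY v hv

/-- The elements `X` of `τ` such that `X ⊗ I` kills `U`. -/
def tauAnn (ρ : B →ₗ[ℂ] τ →ₗ[ℂ] Module.End ℂ V) (U : Submodule ℂ V) (I : Ideal B) :
    Submodule ℂ τ where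
  carrier := {X | ∀ b ∈ I, ∀ v ∈ U, ρ b X v = 0}
  add_mem' := fun hx hy b hb v hv => by
    rw [map_add, LinearMap.add_apply, hx b hb v hv, hy b hb v hv, add_zero]
  zero_mem' := fun b _ v _ => by simp
  smul_mem' := fun c x hx b hb v hv => by
    rw [map_smul, LinearMap.smul_apply, hx b hb v hv, smul_zero]

lemma le_annOn_of_le_tauAnn {U : Submodule ℂ V} {S : Submodule ℂ τ} {I : Ideal B}
    (h : S ≤ tauAnn ρ U I) : I ≤ annOn ρ U S :=
  fun b hb c _ hY v hv => h hY (c * b) (I.mul_mem_left c hb) v hv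

namespace IsCuspidalRep

lemma mul_le_annOn_add (hρ : IsCuspidalRep ρ W N) (hτ : IsFullToroidal n 𝔤 τ κ c₁ c₂ E K W)
    (hn : 2 ≤ n) {U : Submodule ℂ V} {m k : Fin n → ℤ} (hk : k ≠ 0)
    (hkm : k ≠ m) {I J : Ideal B} (hI : I ≤ annOn ρ U (gradedPiece E K W m))
    (hJ : J ≤ annOn ρ U (gradedPiece E K W k)) :
    I * J ≤ annOn ρ U (gradedPiece E K W (m + k)) := by
  refine le_annOn_of_le_tauAnn (hτ.gradedPiece_le_of_lie hn hk hkm fun Y hY Z hZ b hb v hv => ?_)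
  induction hb using Submodule.mul_induction_on' with
  | mem_mul_mem a ha b hb =>
    have h := hρ.apply_apply a b Y Z v
    rw [apply_eq_zero_of_mem_annOn (hJ hb) hZ hv, apply_eq_zero_of_mem_annOn (hI ha) hY hv,
      map_zero, map_zero, zero_add] at h
    exact h.symm
  | add a _ b _ ha hb => rw [map_add, LinearMap.add_apply, LinearMap.add_apply, ha, hb, add_zero]

/-- Once `I` kills the pieces of degrees `±eᵢ, ±2eᵢ` on `U`, some power of `I` kills any
given piece. -/
lemma exists_pow_le_annOn (hρ : IsCuspidalRep ρ W N) (hτ : IsFullToroidal n 𝔤 τ κ c₁ c₂ E K W)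
    (hn : 2 ≤ n) {U : Submodule ℂ V} {I : Ideal B}
    (hI : ∀ i : Fin n, ∀ z ∈ ({1, -1, 2, -2} : Finset ℤ),
      I ≤ annOn ρ U (gradedPiece E K W (Pi.single i z))) (l : Fin n → ℤ) :
    ∃ c, I ^ c ≤ annOn ρ U (gradedPiece E K W l) := by
  have hsingle : ∀ (i : Fin n) (z : ℤ), z ≠ 0 → (Pi.single i z : Fin n → ℤ) ≠ 0 := by
    intro i z hz; simpa using hz
  have hne : ∀ (i : Fin n), (Pi.single i (-1) : Fin n → ℤ) ≠ Pi.single i 1 := by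
    intro i h
    have := congrFun h i
    simp at this
  have hstep : ∀ (z : ℤ), z ∈ ({1, -1} : Finset ℤ) → ∀ (l : Fin n → ℤ) (i : Fin n),
      (∃ c, I ^ c ≤ annOn ρ U (gradedPiece E K W l)) →
      ∃ c, I ^ c ≤ annOn ρ U (gradedPiece E K W (l + Pi.single i z)) := by
    intro z hz l i ⟨c, hc⟩
    have hz0 : z ≠ 0 := by rintro rfl; simp at hz
    have hz1 : z ∈ ({1, -1, 2, -2} : Finset ℤ) := by
      simp only [Finset.mem_insert, Finset.mem_singleton] at hz ⊢; omega
    have hz2 : z + z ∈ ({1, -1, 2, -2} : Finset ℤ) := by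
      simp only [Finset.mem_insert, Finset.mem_singleton] at hz ⊢; omega
    by_cases hl : l = Pi.single i z
    · refine ⟨1, ?_⟩
      rw [pow_one, hl, ← Pi.single_add]
      exact hI i _ hz2
    · refine ⟨c + 1, ?_⟩
      rw [pow_succ]
      exact hρ.mul_le_annOn_add hτ hn (hsingle i z hz0) (Ne.symm hl) hc (hI i z hz1)
  refine forall_of_add_single ⟨2, ?_⟩
    (fun l i hl => ⟨hstep 1 (by simp) l i hl, hstep (-1) (by simp) l i hl⟩) l
  have i : Fin n := ⟨0, by omega⟩
  have h := hρ.mul_le_annOn_add hτ hn (hsingle i (-1) (by norm_num)) (hne i)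
    (hI i 1 (by simp)) (hI i (-1) (by simp))
  rw [← Pi.single_add, add_neg_cancel, Pi.single_zero] at h
  rwa [pow_two]

/-- The algebra `B / annIdeal ρ` through which `τ(B)` acts is finite-dimensional. -/
lemma isArtinianRing_quotient_annIdeal (hρ : IsCuspidalRep ρ W N)
    (hτ : IsFullToroidal n 𝔤 τ κ c₁ c₂ E K W)
    [FiniteDimensional ℂ 𝔤] (hn : 2 ≤ n)
    (hB : Algebra.FiniteType ℂ B) : IsArtinianRing (B ⧸ annIdeal ρ) := by
  obtain ⟨l, hl⟩ := hρ.exists_wt_ne_bot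
  have hsingle : ∀ (i : Fin n) (z : ℤ), z ≠ 0 → (Pi.single i z : Fin n → ℤ) ≠ 0 := by
    intro i z hz; simpa using hz
  set F : Finset (Fin n × ℤ) := Finset.univ ×ˢ {1, -1, 2, -2} with hF
  set J : Fin n × ℤ → Ideal B :=
    fun p => annOn ρ (wt ρ W l) (gradedPiece E K W (Pi.single p.1 p.2)) with hJ
  set I : Ideal B := F.inf J with hI
  have hIJ : ∀ i : Fin n, ∀ z ∈ ({1, -1, 2, -2} : Finset ℤ),
      I ≤ annOn ρ (wt ρ W l) (gradedPiece E K W (Pi.single i z)) := fun i z hz =>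
    Finset.inf_le (f := J) (b := (i, z)) (by
      simp only [hF, Finset.mem_product, Finset.mem_univ, hz, and_self])
  have hpow : ∀ k : Fin n → ℤ, k ≠ 0 →
      I ^ (N * N) ≤ annOn ρ (wt ρ W l) (gradedPiece E K W k) := by
    intro k hk b hb c Y hY
    obtain ⟨d, hd⟩ := hρ.exists_pow_le_annOn hτ hn hIJ k
    have hS : Submodule.span ℂ {Y} ≤ gradedPiece E K W k := by
      rwa [Submodule.span_singleton_le_iff_mem]
    obtain ⟨hfin, hrank⟩ := hρ.finite_quotient_annOn hτ hk hS l
    have hle : I ^ d ≤ annOn ρ (wt ρ W l) (Submodule.span ℂ {Y}) :=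
      fun b hb c Z hZ => hd hb c Z (hS hZ)
    refine pow_le_of_finrank_quotient_le hle (hrank.trans ?_) hb c Y
      (Submodule.mem_span_singleton_self Y)
    calc _ ≤ 1 * (N * N) := Nat.mul_le_mul_right _ ((finrank_span_le_card {Y}).trans (by simp))
      _ = N * N := one_mul _
  have hpow2 : ∀ k : Fin n → ℤ,
      I ^ (N * N + N * N) ≤ annOn ρ (wt ρ W l) (gradedPiece E K W k) := by
    intro k
    by_cases hk : k = 0
    · have i : Fin n := ⟨0, by omega⟩
      have h1 := hsingle i 1 (by norm_num)
      have h2 := hsingle i (-1) (by norm_num)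
      have h := hρ.mul_le_annOn_add hτ hn h2 (fun h => by simpa using congrFun h i)
        (hpow _ h1) (hpow _ h2)
      rw [← Pi.single_add, add_neg_cancel, Pi.single_zero] at h
      rwa [pow_add, hk]
    · exact (Ideal.pow_le_pow_right (Nat.le_add_left _ _)).trans (hpow k hk)
  have hann : I ^ (N * N + N * N) ≤ annIdeal ρ := by
    obtain ⟨v, hv, hv0⟩ := Submodule.exists_mem_ne_zero_of_ne_bot hl
    refine hρ.le_annIdeal_of_mem_killedBy (v := v) (fun b hb X => ?_) hv0
    have : X ∈ tauAnn ρ (wt ρ W l) (I ^ (N * N + N * N)) :=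
      hτ.eq_top_of_gradedPiece_le (S := tauAnn ρ (wt ρ W l) (I ^ (N * N + N * N)))
        (fun k Y hY a ha w hw => apply_eq_zero_of_mem_annOn (hpow2 k ha) hY hw) X
    exact this b hb v hv
  have hprime : ∀ Q : Ideal B, Q.IsPrime → annIdeal ρ ≤ Q → Q.IsMaximal := by
    intro Q hQ hAQ
    obtain ⟨p, hpF, hp⟩ := (hQ.inf_le').mp (hQ.le_of_pow_le (hann.trans hAQ))
    have hp0 : (Pi.single p.1 p.2 : Fin n → ℤ) ≠ 0 := by
      refine hsingle _ _ ?_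
      rintro h0
      simp [hF, h0] at hpF
    have := finite_gradedPiece (E := E) (K := K) (W := W) (Pi.single p.1 p.2)
    have hfin := (hρ.finite_quotient_annOn hτ hp0 le_rfl l).1
    have : Module.Finite ℂ (B ⧸ Q) :=
      Module.Finite.of_surjective (Ideal.Quotient.factorₐ ℂ hp).toLinearMap
        (Ideal.Quotient.factor_surjective hp)
    have : IsArtinianRing (B ⧸ Q) := IsArtinianRing.of_finite ℂ _
    exact Ideal.Quotient.maximal_of_isField _ (IsArtinianRing.isField_of_isDomain _)
  have hnoeth : IsNoetherianRing B := Algebra.FiniteType.isNoetherianRing ℂ B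
  refine isArtinianRing_iff_isNoetherianRing_krullDimLE_zero.mpr ⟨inferInstance, ?_⟩
  refine Ring.krullDimLE_zero_iff.mpr fun P hP => ?_
  have h := hprime (P.comap (Ideal.Quotient.mk _)) (hP.comap _) (by
    intro x hx
    rw [Ideal.mem_comap, Ideal.Quotient.eq_zero_iff_mem.mpr hx]; exact P.zero_mem)
  have := Ideal.map_eq_top_or_isMaximal_of_surjective (Ideal.Quotient.mk (annIdeal ρ))
    Ideal.Quotient.mk_surjective h
  rw [Ideal.map_comap_of_surjective _ Ideal.Quotient.mk_surjective] at this
  exact this.resolve_left hP.ne_top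

end IsCuspidalRep

end Cofinite

section RingLemmas

variable {R : Type*} [Ring R]

lemma pow_mul_of_mul_eq {f T T' : R} (h : f * T = T * f + T') (h' : Commute f T') (k : ℕ) :
    f ^ (k + 1) * T = T * f ^ (k + 1) + (k + 1) • (T' * f ^ k) := by
  induction k with
  | zero => simpa using h
  | succ k ih =>
    calc f ^ (k + 1 + 1) * T = f * (f ^ (k + 1) * T) := by rw [pow_succ' f (k + 1), mul_assoc]
      _ = (f * T) * f ^ (k + 1) + (k + 1) • (f * T' * f ^ k) := by
        rw [ih, mul_add, mul_smul_comm, ← mul_assoc, ← mul_assoc]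
      _ = T * f ^ (k + 1 + 1) + (k + 1 + 1) • (T' * f ^ (k + 1)) := by
        rw [h, h'.eq, add_mul, mul_assoc, ← pow_succ', mul_assoc T', ← pow_succ', add_assoc]
        congr 1
        rw [succ_nsmul' _ (k + 1)]

lemma mul_pow_of_mul_eq {f X g : R} (h : X * f = f * X + g) (h' : Commute f g) (k : ℕ) :
    X * f ^ (k + 1) = f ^ (k + 1) * X + (k + 1) • (g * f ^ k) := by
  have h1 : f * X = X * f + -g := by rw [h]; abel
  rw [pow_mul_of_mul_eq h1 h'.neg_right k, neg_mul, smul_neg]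
  abel

variable [Algebra ℂ R]

lemma pow_eq_zero_of_commutator {f e x : R} {a : ℂ} (ha : a ≠ 0) (hfe : f * e = e * f + a • x)
    (hex : Commute e x) (hfx : Commute f x) {M : ℕ} (hf : f ^ M = 0) : x ^ M = 0 := by
  have key : ∀ j k, j + k = M → x ^ j * f ^ k = 0 := by
    intro j
    induction j with
    | zero => intro k hk; rw [← hk, zero_add] at hf; rw [hf, mul_zero]
    | succ j ih =>
      intro k hk
      have h1 := ih (k + 1) (by omega)
      have h2 := pow_mul_of_mul_eq hfe (hfx.smul_right a) k
      have h3 : x ^ j * (f ^ (k + 1) * e) = 0 := by rw [← mul_assoc, h1, zero_mul]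
      rw [h2, mul_add, ← mul_assoc, ← (hex.pow_right j).eq, mul_assoc, h1, mul_zero, zero_add,
        mul_smul_comm, smul_mul_assoc, mul_smul_comm, ← mul_assoc, ← pow_succ,
        ← Nat.cast_smul_eq_nsmul ℂ, smul_smul] at h3
      exact (smul_eq_zero.mp h3).resolve_left (mul_ne_zero (by exact_mod_cast k.succ_ne_zero) ha)
  simpa using key M 0 rfl

lemma isNilpotent_of_commutator {f g h X : R} (hf : X * f = f * X + g) (hg : X * g = g * X + h)
    (hfg : Commute f g) (hfh : Commute f h) (hgh : Commute g h) (hn : IsNilpotent f) :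
    IsNilpotent g := by
  obtain ⟨M, hM⟩ := hn
  refine ⟨2 * M, ?_⟩
  have hXg : ∀ i : ℕ, X * g ^ i * g = g ^ i * X * g + i • (h * g ^ i) := by
    intro i
    cases i with
    | zero => simp
    | succ i =>
      rw [mul_pow_of_mul_eq hg hgh i, add_mul, smul_mul_assoc, mul_assoc h, ← pow_succ]
  have key : ∀ j k, j + k = M → f ^ k * g ^ (2 * j) = 0 := by
    intro j
    induction j with
    | zero => intro k hk; rw [← hk, zero_add] at hM; rw [hM, zero_mul]
    | succ j ih =>
      intro k hk
      have h1 := ih (k + 1) (by omega)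
      have h0 : X * (f ^ (k + 1) * g ^ (2 * j)) * g = 0 := by rw [h1, mul_zero, zero_mul]
      have h2 : X * (f ^ (k + 1) * g ^ (2 * j)) * g =
          f ^ (k + 1) * (X * g ^ (2 * j) * g) + (k + 1) • (g * f ^ k * g ^ (2 * j) * g) := by
        rw [← mul_assoc, mul_pow_of_mul_eq hf hfg k, add_mul, add_mul, smul_mul_assoc,
          smul_mul_assoc]
        simp only [mul_assoc]
      have h3 : f ^ (k + 1) * (X * g ^ (2 * j) * g) = 0 := by
        rw [hXg, mul_add, mul_smul_comm, ← mul_assoc, ← mul_assoc, ← mul_assoc, h1,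
          (hfh.pow_left (k + 1)).eq, mul_assoc h, h1]
        simp
      have h4 : g * f ^ k * g ^ (2 * j) * g = f ^ k * g ^ (2 * (j + 1)) := by
        rw [← (hfg.pow_left k).eq, mul_assoc (f ^ k), ← pow_succ', mul_assoc, ← pow_succ]
        congr 1
      rw [h2, h3, zero_add, h4, ← Nat.cast_smul_eq_nsmul ℂ] at h0
      exact (smul_eq_zero.mp h0).resolve_left (by exact_mod_cast k.succ_ne_zero)
  simpa using key M 0 rfl

end RingLemmas

/-- Commuting nilpotent operators preserving a nonzero subspace have a common kernel vector
in it. -/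
lemma exists_common_kernel {V : Type*} [AddCommGroup V] [Module ℂ V]
    (s : Finset (Module.End ℂ V)) (T : Submodule ℂ V) (hT : T ≠ ⊥)
    (hcomm : ∀ f ∈ s, ∀ g ∈ s, Commute f g) (hnil : ∀ f ∈ s, IsNilpotent f)
    (hpres : ∀ f ∈ s, ∀ v ∈ T, f v ∈ T) : ∃ v ∈ T, v ≠ 0 ∧ ∀ f ∈ s, f v = 0 := by
  classical
  induction s using Finset.induction_on generalizing T with
  | empty =>
    obtain ⟨v, hv, hv0⟩ := Submodule.exists_mem_ne_zero_of_ne_bot hT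
    exact ⟨v, hv, hv0, by simp⟩
  | insert f s _ ih =>
    have hfs := Finset.mem_insert_self f s
    have hs : ∀ g ∈ s, g ∈ insert f s := fun g hg => Finset.mem_insert_of_mem hg
    have hT' : T ⊓ LinearMap.ker f ≠ ⊥ := by
      intro hbot
      obtain ⟨k, hk⟩ := hnil f hfs
      obtain ⟨v, hv, hv0⟩ := Submodule.exists_mem_ne_zero_of_ne_bot hT
      have hne : ∀ j, (f ^ j) v ∈ T ∧ (f ^ j) v ≠ 0 := by
        intro j
        induction j with
        | zero => simpa using ⟨hv, hv0⟩
        | succ j ihj =>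
          rw [pow_succ', Module.End.mul_apply]
          refine ⟨hpres f hfs _ ihj.1, fun h0 => ihj.2 ?_⟩
          have : (f ^ j) v ∈ T ⊓ LinearMap.ker f := ⟨ihj.1, h0⟩
          rwa [hbot, Submodule.mem_bot] at this
      exact (hne k).2 (by rw [hk, LinearMap.zero_apply])
    obtain ⟨v, hv, hv0, hvs⟩ := ih (T ⊓ LinearMap.ker f) hT'
      (fun g hg g' hg' => hcomm g (hs g hg) g' (hs g' hg')) (fun g hg => hnil g (hs g hg))
      (fun g hg v hv => ⟨hpres g (hs g hg) v hv.1, by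
        have hc := LinearMap.congr_fun (hcomm f hfs g (hs g hg)).eq v
        rw [Module.End.mul_apply, Module.End.mul_apply, LinearMap.mem_ker.mp hv.2, map_zero] at hc
        exact hc⟩)
    refine ⟨v, hv.1, hv0, fun g hg => ?_⟩
    rcases Finset.mem_insert.mp hg with rfl | hg
    · exact hv.2
    · exact hvs g hg

section Radical

variable {B : Type} [CommRing B] [Algebra ℂ B] {V : Type} [AddCommGroup V] [Module ℂ V]
variable {κ : 𝔤 →ₗ[ℂ] 𝔤 →ₗ[ℂ] ℂ} {c₁ c₂ : ℂ}
  {E : (Fin n → ℤ) → 𝔤 →ₗ[ℂ] τ} {K W : (Fin n → ℤ) → Fin n → τ}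
  {ρ : B →ₗ[ℂ] τ →ₗ[ℂ] Module.End ℂ V} {N : ℕ}

namespace IsCuspidalRep

lemma mul_eq (hρ : IsCuspidalRep ρ W N)
    (a b : B) (X Y : τ) : ρ a X * ρ b Y = ρ b Y * ρ a X + ρ (a * b) ⁅X, Y⁆ :=
  LinearMap.ext fun v => hρ.apply_apply a b X Y v

lemma commute_of_mul_mem (hρ : IsCuspidalRep ρ W N) {a b : B} (h : a * b ∈ annIdeal ρ) (X Y : τ) :
    Commute (ρ a X) (ρ b Y) := by
  have h0 : ρ (a * b) ⁅X, Y⁆ = 0 := by simpa using h 1 ⁅X, Y⁆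
  rw [commute_iff_eq, hρ.mul_eq, h0, add_zero]

lemma commute_of_sq_mem (hρ : IsCuspidalRep ρ W N)
    {p : B} (hp : p * p ∈ annIdeal ρ) (a b : B) (X Y : τ) :
    Commute (ρ (a * p) X) (ρ (b * p) Y) := by
  refine hρ.commute_of_mul_mem ?_ X Y
  rw [mul_mul_mul_comm]
  exact Ideal.mul_mem_left _ _ hp

lemma exists_eigenvector (hρ : IsCuspidalRep ρ W N)
    {l : Fin n → ℂ} {U : Submodule ℂ V} (hU : U ≤ wt ρ W l) (hU0 : U ≠ ⊥)
    {f : Module.End ℂ V} (hf : ∀ v ∈ U, f v ∈ U) : ∃ c : ℂ, ∃ v ∈ U, v ≠ 0 ∧ f v = c • v := by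
  have := hρ.finite_wt l
  have : FiniteDimensional ℂ U := Submodule.finiteDimensional_of_le hU
  have : Nontrivial U := Submodule.nontrivial_iff_ne_bot.mpr hU0
  obtain ⟨c, hc⟩ := Module.End.exists_eigenvalue (f.restrict hf)
  obtain ⟨v, hv⟩ := hc.exists_hasEigenvector
  exact ⟨c, v, v.2, fun h => hv.2 (Subtype.ext h), congrArg Subtype.val hv.apply_eq_smul⟩

lemma exists_sub_pow_eq_zero (hρ : IsCuspidalRep ρ W N)
    (hτ : IsFullToroidal n 𝔤 τ κ c₁ c₂ E K W) {p : B}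
    (hp : p * p ∈ annIdeal ρ) {X₀ : τ} (hX₀ : X₀ ∈ gradedPiece E K W 0) :
    ∃ c : ℂ, (ρ p X₀ - algebraMap ℂ (Module.End ℂ V) c) ^ N = 0 := by
  have hz : ∀ l, ∀ v ∈ wt ρ W l, ρ p X₀ v ∈ wt ρ W l :=
    fun l v hv => hρ.apply_mem_wt_self hτ hX₀ p hv
  obtain ⟨l, hl⟩ := hρ.exists_wt_ne_bot
  obtain ⟨c, v, -, hv0, hv⟩ := hρ.exists_eigenvector le_rfl hl (hz l)
  refine ⟨c, ?_⟩
  set f := ρ p X₀ - algebraMap ℂ (Module.End ℂ V) c with hf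
  have hfwt : ∀ l, ∀ v ∈ wt ρ W l, f v ∈ wt ρ W l := fun l v hv =>
    Submodule.sub_mem _ (hz l v hv) (Submodule.smul_mem _ c hv)
  let U : Submodule ℂ V :=
    { carrier := {w | ∃ k, (f ^ k) w = 0}
      add_mem' := by
        rintro a b ⟨k, hk⟩ ⟨j, hj⟩
        refine ⟨k + j, ?_⟩
        rw [map_add, pow_add, Module.End.mul_apply, Module.End.mul_apply, hj, map_zero, add_zero,
          ← Module.End.mul_apply, (Commute.pow_pow_self f k j).eq, Module.End.mul_apply, hk,
          map_zero]
      zero_mem' := ⟨0, map_zero _⟩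
      smul_mem' := by
        rintro a b ⟨k, hk⟩
        exact ⟨k, by rw [map_smul, hk, smul_zero]⟩ }
  have hU : U = ⊤ := by
    refine hρ.eq_top_of_mem (v := v) ?_ ⟨1, ?_⟩ hv0
    · rintro b X w ⟨k, hk⟩
      refine ⟨k + 1, ?_⟩
      have h1 : f * ρ b X = ρ b X * f + ρ (p * b) ⁅X₀, X⁆ := by
        rw [hf, sub_mul, mul_sub, hρ.mul_eq, Algebra.commutes]; abel
      have h2 : Commute f (ρ (p * b) ⁅X₀, X⁆) := by
        refine Commute.sub_left (hρ.commute_of_mul_mem ?_ _ _) (Algebra.commutes _ _)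
        rw [← mul_assoc]
        exact Ideal.mul_mem_right _ _ hp
      have h3 := LinearMap.congr_fun (pow_mul_of_mul_eq h1 h2 k) w
      rw [Module.End.mul_apply] at h3
      rw [h3, pow_succ']
      simp [hk]
    · rw [pow_one, hf, LinearMap.sub_apply, hv, Module.algebraMap_end_apply, sub_self]
  have hle : (⨆ l, wt ρ W l) ≤ LinearMap.ker (f ^ N) := by
    refine iSup_le fun l w hw => ?_
    obtain ⟨k, hk⟩ : w ∈ U := hU ▸ trivial
    have := hρ.finite_wt l
    have hpow : ∀ j, ((f.restrict (hfwt l)) ^ j) ⟨w, hw⟩ = 0 ↔ (f ^ j) w = 0 := by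
      intro j
      rw [Module.End.pow_restrict, ← Subtype.coe_inj]
      rfl
    have h1 : (⟨w, hw⟩ : wt ρ W l) ∈ LinearMap.ker ((f.restrict (hfwt l)) ^ k) :=
      (hpow k).mpr hk
    have h2 := (hpow _).mp (Module.End.ker_pow_le_ker_pow_finrank _ _ h1)
    obtain ⟨d, hd⟩ := Nat.exists_eq_add_of_le (hρ.finrank_wt_le l)
    rw [LinearMap.mem_ker, hd, add_comm, pow_add, Module.End.mul_apply, h2, map_zero]
  rw [hρ.iSup_wt] at hle
  exact LinearMap.ker_eq_top.mp (top_le_iff.mp hle)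

lemma vec_pow_eq_zero (hρ : IsCuspidalRep ρ W N) (hτ : IsFullToroidal n 𝔤 τ κ c₁ c₂ E K W) {p : B}
    (hp : p * p ∈ annIdeal ρ) {u : Fin n → ℂ} (hu : IsGeneric u) {m : Fin n → ℤ} (hm : m ≠ 0) :
    (ρ p (vec W m u)) ^ N = 0 := by
  have hm0 : vec W m u ∈ gradedPiece E K W m := vec_W_mem_gradedPiece m u
  obtain ⟨c, hc⟩ := hρ.exists_sub_pow_eq_zero hτ hp
    (vec_W_mem_gradedPiece (E := E) (K := K) (W := W) 0 u)
  refine pow_eq_zero_of_commutator (e := ρ 1 (vec W m u)) (hu m hm) ?_ ?_ ?_ hc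
  · rw [sub_mul, mul_sub, hρ.mul_eq, Algebra.commutes, hτ.lie_vec_zero u hm0, mul_one, map_smul]
    abel
  · rw [commute_iff_eq, hρ.mul_eq, lie_self, map_zero, add_zero]
  · exact Commute.sub_left (hρ.commute_of_mul_mem hp _ _) (Algebra.commutes _ _)

lemma isNilpotent_of_sq_mem (hρ : IsCuspidalRep ρ W N)
    (hτ : IsFullToroidal n 𝔤 τ κ c₁ c₂ E K W) (hn : 2 ≤ n) {p : B}
    (hp : p * p ∈ annIdeal ρ) (b : B) (Y : τ) : IsNilpotent (ρ (b * p) Y) := by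
  obtain ⟨u, hu⟩ := exists_isGeneric n
  let S : Submodule ℂ τ :=
    { carrier := {Y | ∀ b, IsNilpotent (ρ (b * p) Y)}
      add_mem' := fun hx hy b => by
        rw [map_add]
        exact (hρ.commute_of_sq_mem hp b b _ _).isNilpotent_add (hx b) (hy b)
      zero_mem' := fun b => by rw [map_zero]; exact IsNilpotent.zero
      smul_mem' := fun c x hx b => by rw [map_smul]; exact (hx b).smul c }
  have hS : ∀ X : τ, ∀ Y ∈ S, ⁅X, Y⁆ ∈ S := by
    intro X Y hY b
    have h1 := hρ.mul_eq 1 (b * p) X Y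
    have h2 := hρ.mul_eq 1 (b * p) X ⁅X, Y⁆
    rw [one_mul] at h1 h2
    exact isNilpotent_of_commutator h1 h2 (hρ.commute_of_sq_mem hp _ _ _ _)
      (hρ.commute_of_sq_mem hp _ _ _ _) (hρ.commute_of_sq_mem hp _ _ _ _) (hY b)
  have hvec : ∀ m : Fin n → ℤ, m ≠ 0 → vec W m u ∈ S := by
    intro m hm b
    refine ⟨N, hρ.vec_pow_eq_zero hτ ?_ hu hm⟩
    rw [mul_mul_mul_comm]
    exact Ideal.mul_mem_left _ _ hp
  have hne : ∀ l : Fin n → ℤ, l ≠ 0 → gradedPiece E K W l ≤ S := by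
    intro l hl
    have hadd : -l + (l + l) = l := by abel
    have h2 : l + l ≠ 0 := by
      intro h
      refine hl (funext fun i => ?_)
      have := congrFun h i
      simp only [Pi.add_apply, Pi.zero_apply] at this ⊢
      omega
    have h3 : l + l ≠ -l := by
      intro h
      refine hl (funext fun i => ?_)
      have := congrFun h i
      simp only [Pi.add_apply, Pi.neg_apply, Pi.zero_apply] at this ⊢
      omega
    have := hτ.gradedPiece_le_of_lie_vec' hu (m := -l) (k := l + l) (S := S) h2 h3
      (by rwa [hadd]) fun Y _ => by
        rw [← lie_skew]
        exact S.neg_mem (hS _ _ (hvec _ (neg_ne_zero.mpr hl)))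
    rwa [hadd] at this
  refine hτ.eq_top_of_gradedPiece_le (S := S) (fun l => ?_) Y b
  by_cases hl : l = 0
  · let i : Fin n := ⟨0, by omega⟩
    have h1 : (Pi.single i (-1) : Fin n → ℤ) ≠ 0 := by simp
    have h2 : (Pi.single i (-1) : Fin n → ℤ) ≠ Pi.single i 1 := fun h => by
      simpa using congrFun h i
    have h := hτ.gradedPiece_le_of_lie hn h1 h2 (S := S) fun Y _ Z hZ => hS Y Z (hne _ h1 hZ)
    rwa [← Pi.single_add, add_neg_cancel, Pi.single_zero, ← hl] at h
  · exact hne l hl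

end IsCuspidalRep

end Radical

section RadicalIdeal

variable {B : Type} [CommRing B] [Algebra ℂ B] {V : Type} [AddCommGroup V] [Module ℂ V]
variable {κ : 𝔤 →ₗ[ℂ] 𝔤 →ₗ[ℂ] ℂ} {c₁ c₂ : ℂ}
  {E : (Fin n → ℤ) → 𝔤 →ₗ[ℂ] τ} {K W : (Fin n → ℤ) → Fin n → τ}
  {ρ : B →ₗ[ℂ] τ →ₗ[ℂ] Module.End ℂ V} {N : ℕ}

/-- For finite-dimensional `F ≤ τ`, the operators `ρ (b * p) Y` with `Y ∈ F` are spanned by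
finitely many of them. -/
lemma exists_finset_span_action (hfin : Module.Finite ℂ (B ⧸ annIdeal ρ)) (p : B)
    (F : Submodule ℂ τ) (hF : F.FG) :
    ∃ t : Finset (Module.End ℂ V), (∀ f ∈ t, ∃ b, ∃ Y, f = ρ (b * p) Y) ∧
      ∀ b, ∀ Y ∈ F, ρ (b * p) Y ∈ Submodule.span ℂ (t : Set (Module.End ℂ V)) := by
  let g : B →ₗ[ℂ] τ →ₗ[ℂ] Module.End ℂ V := ρ ∘ₗ LinearMap.mulRight ℂ p
  have hker : (annIdeal ρ).restrictScalars ℂ ≤ LinearMap.ker g := by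
    intro b hb
    refine LinearMap.mem_ker.mpr (LinearMap.ext fun Y => ?_)
    change ρ (b * p) Y = 0
    rw [mul_comm]; exact hb p Y
  have hg : (LinearMap.range g).FG := by
    have : Module.Finite ℂ (B ⧸ (annIdeal ρ).restrictScalars ℂ) :=
      Module.Finite.equiv (Submodule.Quotient.restrictScalarsEquiv ℂ (annIdeal ρ)).symm
    rw [← Submodule.range_liftQ _ g hker, ← Module.Finite.iff_fg]
    infer_instance
  have hO : (Submodule.map₂ LinearMap.id (LinearMap.range g) F).FG := hg.map₂ _ hF
  have hspan : Submodule.map₂ LinearMap.id (LinearMap.range g) F =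
      Submodule.span ℂ (Set.image2 (fun (r : τ →ₗ[ℂ] Module.End ℂ V) Y => r Y)
        (LinearMap.range g : Set (τ →ₗ[ℂ] Module.End ℂ V)) (F : Set τ)) := by
    have h := Submodule.map₂_span_span ℂ (LinearMap.id : (τ →ₗ[ℂ] Module.End ℂ V) →ₗ[ℂ] _)
      (LinearMap.range g : Set _) (F : Set τ)
    rwa [Submodule.span_eq, Submodule.span_eq] at h
  rw [hspan, Submodule.fg_span_iff_fg_span_finset_subset] at hO
  obtain ⟨t, ht, hts⟩ := hO
  refine ⟨t, fun f hf => ?_, fun b Y hY => ?_⟩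
  · obtain ⟨_, ⟨b, rfl⟩, Y, -, rfl⟩ := ht hf
    exact ⟨b, Y, rfl⟩
  · rw [← hts]
    exact Submodule.subset_span ⟨g b, ⟨b, rfl⟩, Y, hY, rfl⟩

namespace IsCuspidalRep

lemma mem_annIdeal_of_sq_mem (hρ : IsCuspidalRep ρ W N) (hτ : IsFullToroidal n 𝔤 τ κ c₁ c₂ E K W)
    [FiniteDimensional ℂ 𝔤] (hn : 2 ≤ n) (hfin : Module.Finite ℂ (B ⧸ annIdeal ρ)) {p : B}
    (hp : p * p ∈ annIdeal ρ) : p ∈ annIdeal ρ := by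
  have hV := hρ.nontrivial
  obtain ⟨u, hu⟩ := exists_isGeneric n
  let i : Fin n := ⟨0, by omega⟩
  let m : Fin n → ℤ := Pi.single i 1
  have hm : m ≠ 0 := by simp [m]
  set x := ρ p (vec W m u) with hx
  obtain ⟨M, hM, hM'⟩ : ∃ M, x ^ (M + 1) = 0 ∧ x ^ M ≠ 0 := by
    classical
    have hex : ∃ k, x ^ k = 0 := ⟨N, hρ.vec_pow_eq_zero hτ hp hu hm⟩
    have h0 : Nat.find hex ≠ 0 := fun h => by
      have := Nat.find_spec hex
      rw [h, pow_zero] at this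
      exact one_ne_zero this
    obtain ⟨M, hM⟩ := Nat.exists_eq_succ_of_ne_zero h0
    refine ⟨M, ?_, Nat.find_min hex (by omega)⟩
    have := Nat.find_spec hex
    rwa [hM] at this
  have hkill : ∀ b X, ρ (b * p) ⁅vec W m u, X⁆ * x ^ M = 0 := by
    intro b X
    have h1 : x * ρ b X = ρ b X * x + ρ (b * p) ⁅vec W m u, X⁆ := by
      rw [hx, hρ.mul_eq, mul_comm p b]
    have hc : Commute x (ρ (b * p) ⁅vec W m u, X⁆) := by
      have := hρ.commute_of_sq_mem hp 1 b (vec W m u) ⁅vec W m u, X⁆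
      rwa [one_mul] at this
    have h2 := pow_mul_of_mul_eq h1 hc M
    rw [hM, zero_mul, mul_zero, zero_add, ← Nat.cast_smul_eq_nsmul ℂ] at h2
    exact (smul_eq_zero.mp h2.symm).resolve_left (by exact_mod_cast M.succ_ne_zero)
  let S : Submodule ℂ τ :=
    { carrier := {Y | ∀ b, ρ (b * p) Y * x ^ M = 0}
      add_mem' := fun hx hy b => by rw [map_add, add_mul, hx b, hy b, add_zero]
      zero_mem' := fun b => by rw [map_zero, zero_mul]
      smul_mem' := fun c x hx b => by rw [map_smul, smul_mul_assoc, hx b, smul_zero] }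
  have hS : ∀ l : Fin n → ℤ, l ≠ 0 → l ≠ m → l ≠ m + m → gradedPiece E K W l ≤ S := by
    intro l h0 h1 h2
    have hadd : m + (l - m) = l := by abel
    have := hτ.gradedPiece_le_of_lie_vec' hu (m := m) (k := l - m) (S := S) (sub_ne_zero.mpr h1)
      (fun h => h2 (sub_eq_iff_eq_add.mp h)) (by rwa [hadd]) fun Y _ b => hkill b Y
    rwa [hadd] at this
  let F : Submodule ℂ τ := gradedPiece E K W 0 ⊔ gradedPiece E K W m ⊔ gradedPiece E K W (m + m)
  have hF : F.FG := by
    refine Submodule.FG.sup (Submodule.FG.sup ?_ ?_) ?_ <;>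
    exact Module.Finite.iff_fg.mp (finite_gradedPiece _)
  obtain ⟨t, ht, hts⟩ := exists_finset_span_action hfin p F hF
  obtain ⟨v, hvT, hv0, hvt⟩ := exists_common_kernel t (LinearMap.range (x ^ M))
    (fun h => hM' (LinearMap.range_eq_bot.mp h))
    (by
      intro f hf g hg
      obtain ⟨b, Y, rfl⟩ := ht f hf
      obtain ⟨b', Y', rfl⟩ := ht g hg
      exact hρ.commute_of_sq_mem hp _ _ _ _)
    (by
      intro f hf
      obtain ⟨b, Y, rfl⟩ := ht f hf
      exact hρ.isNilpotent_of_sq_mem hτ hn hp b Y)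
    (by
      rintro f hf _ ⟨w, rfl⟩
      obtain ⟨b, Y, rfl⟩ := ht f hf
      have hc : Commute x (ρ (b * p) Y) := by
        have := hρ.commute_of_sq_mem hp 1 b (vec W m u) Y
        rwa [one_mul] at this
      exact ⟨ρ (b * p) Y w, LinearMap.congr_fun (hc.pow_left M).eq w⟩)
  have hvF : ∀ b, ∀ Y ∈ F, ρ (b * p) Y v = 0 := by
    intro b Y hY
    have hle : Submodule.span ℂ (t : Set (Module.End ℂ V)) ≤
        LinearMap.ker (LinearMap.applyₗ (R := ℂ) (M := V) (M₂ := V) v) :=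
      Submodule.span_le.mpr fun f hf => hvt f hf
    exact hle (hts b Y hY)
  let Q : Submodule ℂ τ :=
    { carrier := {Y | ∀ b, ρ (b * p) Y v = 0}
      add_mem' := fun hx hy b => by rw [map_add, LinearMap.add_apply, hx b, hy b, add_zero]
      zero_mem' := fun b => by rw [map_zero, LinearMap.zero_apply]
      smul_mem' := fun c x hx b => by rw [map_smul, LinearMap.smul_apply, hx b, smul_zero] }
  have hSQ : S ≤ Q := by
    intro Y hY b
    obtain ⟨w, rfl⟩ := hvT
    exact LinearMap.congr_fun (hY b) w
  have hFQ : F ≤ Q := fun Y hY b => hvF b Y hY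
  have hFQ' := sup_le_iff.mp hFQ
  have hQ : ∀ Y, Y ∈ Q := hτ.eq_top_of_gradedPiece_le fun l => by
    by_cases h0 : l = 0
    · exact h0 ▸ (sup_le_iff.mp hFQ'.1).1
    by_cases h1 : l = m
    · exact h1 ▸ (sup_le_iff.mp hFQ'.1).2
    by_cases h2 : l = m + m
    · exact h2 ▸ hFQ'.2
    exact (hS l h0 h1 h2).trans hSQ
  refine hρ.le_annIdeal_of_mem_killedBy (I := Ideal.span {p}) (v := v) (fun b hb X => ?_) hv0
    (Ideal.mem_span_singleton_self p)
  obtain ⟨c, rfl⟩ := Ideal.mem_span_singleton'.mp hb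
  exact hQ X c

end IsCuspidalRep

end RadicalIdeal

section Idempotent

variable {B : Type} [CommRing B] [Algebra ℂ B] {V : Type} [AddCommGroup V] [Module ℂ V]
variable {κ : 𝔤 →ₗ[ℂ] 𝔤 →ₗ[ℂ] ℂ} {c₁ c₂ : ℂ}
  {E : (Fin n → ℤ) → 𝔤 →ₗ[ℂ] τ} {K W : (Fin n → ℤ) → Fin n → τ}
  {ρ : B →ₗ[ℂ] τ →ₗ[ℂ] Module.End ℂ V} {N : ℕ}

/-- `v` is a nonzero vector of weight `l` which is an eigenvector of `p ⊗ dᵢ` and `p ⊗ dⱼ` with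
eigenvalues `a` and `b`. -/
structure JointEigen (ρ : B →ₗ[ℂ] τ →ₗ[ℂ] Module.End ℂ V) (W : (Fin n → ℤ) → Fin n → τ)
    (i j : Fin n) (p : B) (l : Fin n → ℂ) (a b : ℂ) (v : V) : Prop where
  mem_wt : v ∈ wt ρ W l
  ne_zero : v ≠ 0
  left : ρ p (W 0 i) v = a • v
  right : ρ p (W 0 j) v = b • v

lemma JointEigen.compl {i j : Fin n} {p q : B} (hpq : p + q = 1) {l : Fin n → ℂ} {a b : ℂ} {v : V}
    (h : JointEigen ρ W i j p l a b v) : JointEigen ρ W i j q l (l i - a) (l j - b) v := by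
  obtain rfl : q = 1 - p := eq_sub_of_add_eq' hpq
  refine ⟨h.mem_wt, h.ne_zero, ?_, ?_⟩
  · rw [map_sub, LinearMap.sub_apply, LinearMap.sub_apply, h.mem_wt i, h.left, sub_smul]
  · rw [map_sub, LinearMap.sub_apply, LinearMap.sub_apply, h.mem_wt j, h.right, sub_smul]

lemma apply_eq_of_sub_mem {b c : B} (h : b - c ∈ annIdeal ρ) (X : τ) : ρ b X = ρ c X := by
  have := h 1 X
  rwa [one_mul, map_sub, LinearMap.sub_apply, sub_eq_zero] at this

lemma sub_mem_of_mul_mem {p q : B} (hpq : p + q = 1) (h : p * q ∈ annIdeal ρ) (c : B) :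
    p * (c * p) - c * p ∈ annIdeal ρ := by
  obtain rfl : q = 1 - p := eq_sub_of_add_eq' hpq
  have : p * (c * p) - c * p = -c * (p * (1 - p)) := by ring
  rw [this]
  exact Ideal.mul_mem_left _ _ h

namespace IsCuspidalRep

lemma jointEigen_apply_same (hρ : IsCuspidalRep ρ W N)
    (hτ : IsFullToroidal n 𝔤 τ κ c₁ c₂ E K W) {i j : Fin n} {p q : B}
    (hpq : p + q = 1) (hA : p * q ∈ annIdeal ρ) {l : Fin n → ℂ} {a b : ℂ} {v : V}
    (h : JointEigen ρ W i j p l a b v) {m : Fin n → ℤ} {Y : τ} (hY : Y ∈ gradedPiece E K W m)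
    (c : B) (h0 : ρ (c * p) Y v ≠ 0) :
    JointEigen ρ W i j p (l + fun i => (m i : ℂ)) (a + m i) (b + m j) (ρ (c * p) Y v) := by
  refine ⟨hρ.apply_mem_wt hτ hY _ h.mem_wt, h0, ?_, ?_⟩
  · rw [hρ.degree_apply hτ hY, h.left, map_smul,
      apply_eq_of_sub_mem (sub_mem_of_mul_mem hpq hA c), add_smul]
  · rw [hρ.degree_apply hτ hY, h.right, map_smul,
      apply_eq_of_sub_mem (sub_mem_of_mul_mem hpq hA c), add_smul]

lemma jointEigen_apply_other (hρ : IsCuspidalRep ρ W N)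
    (hτ : IsFullToroidal n 𝔤 τ κ c₁ c₂ E K W) {i j : Fin n} {p q : B}
    (hA : p * q ∈ annIdeal ρ) {l : Fin n → ℂ} {a b : ℂ} {v : V}
    (h : JointEigen ρ W i j p l a b v) {m : Fin n → ℤ} {Y : τ} (hY : Y ∈ gradedPiece E K W m)
    (c : B) (h0 : ρ (c * q) Y v ≠ 0) :
    JointEigen ρ W i j p (l + fun i => (m i : ℂ)) a b (ρ (c * q) Y v) := by
  have hz : ρ (p * (c * q)) Y = 0 := by
    rw [mul_left_comm]; exact hA c Y
  refine ⟨hρ.apply_mem_wt hτ hY _ h.mem_wt, h0, ?_, ?_⟩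
  · rw [hρ.degree_apply hτ hY, h.left, map_smul, hz, LinearMap.zero_apply, smul_zero, add_zero]
  · rw [hρ.degree_apply hτ hY, h.right, map_smul, hz, LinearMap.zero_apply, smul_zero, add_zero]

lemma exists_apply_ne_zero (hρ : IsCuspidalRep ρ W N)
    (hτ : IsFullToroidal n 𝔤 τ κ c₁ c₂ E K W) (hn : 2 ≤ n) (j : Fin n)
    {p q : B} (hpq : p + q = 1) (hA : p * q ∈ annIdeal ρ) (hp : p ∉ annIdeal ρ) {v : V}
    (hv : v ≠ 0) : ∃ m : Fin n → ℤ, m j ≠ 0 ∧ ∃ Y ∈ gradedPiece E K W m, ∃ c,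
      ρ (c * p) Y v ≠ 0 := by
  by_contra! hcon
  let Q : Submodule ℂ τ :=
    { carrier := {Y | ∀ b, ρ (b * p) Y v = 0}
      add_mem' := fun hx hy b => by rw [map_add, LinearMap.add_apply, hx b, hy b, add_zero]
      zero_mem' := fun b => by rw [map_zero, LinearMap.zero_apply]
      smul_mem' := fun c x hx b => by rw [map_smul, LinearMap.smul_apply, hx b, smul_zero] }
  have hQ : ∀ Y, Y ∈ Q := hτ.eq_top_of_gradedPiece_le fun l => by
    by_cases hl : l j = 0
    · have h1 : l - Pi.single j 1 ≠ 0 := fun h => by simpa [hl] using congrFun h j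
      have h2 : l - Pi.single j 1 ≠ Pi.single j 1 := fun h => by
        have := congrFun h j
        simp [hl] at this
      have h := hτ.gradedPiece_le_of_lie hn h1 h2 (S := Q) fun Y hY Z hZ b => by
        have h3 := hρ.apply_apply p (b * p) Y Z v
        have h4 : ρ p Y v = 0 := by
          have := hcon _ (by simp) Y hY 1
          rwa [one_mul] at this
        rw [hcon _ (by simp [hl]) Z hZ b, h4, map_zero, map_zero, zero_add,
          apply_eq_of_sub_mem (sub_mem_of_mul_mem hpq hA b)] at h3
        exact h3.symm
      rwa [add_sub_cancel] at h
    · exact fun Y hY b => hcon l hl Y hY b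
  refine hp (hρ.le_annIdeal_of_mem_killedBy (I := Ideal.span {p}) (v := v) (fun b hb X => ?_) hv
    (Ideal.mem_span_singleton_self p))
  obtain ⟨c, rfl⟩ := Ideal.mem_span_singleton'.mp hb
  exact hQ X c

lemma exists_apply_ne_zero_of_eigenvalue_ne_zero (hρ : IsCuspidalRep ρ W N)
    (hτ : IsFullToroidal n 𝔤 τ κ c₁ c₂ E K W)
    {i j : Fin n} (hij : i ≠ j) {p q : B} (hpq : p + q = 1) (hA : p * q ∈ annIdeal ρ)
    {l : Fin n → ℂ} {a b : ℂ} {v : V} (h : JointEigen ρ W i j p l a b v) (hb : b ≠ 0)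
    {r : ℕ} (hr : 0 < r) : ∃ z : ℤ, z.natAbs = r ∧
      ∃ Y ∈ gradedPiece E K W (Pi.single i z), ρ p Y v ≠ 0 := by
  by_contra! hcon
  have h1 := hcon r (by simp) _ (W_mem_gradedPiece _ i)
  have h2 := hcon (-r) (by simp) _ (W_mem_gradedPiece _ j)
  have h3 := hρ.apply_apply p p (W (Pi.single i (r : ℤ)) i) (W (Pi.single i (-(r : ℤ))) j) v
  have h4 : p * p - p ∈ annIdeal ρ := by simpa using sub_mem_of_mul_mem hpq hA 1
  rw [h1, h2, map_zero, map_zero, zero_add, hτ.lie_W_W, apply_eq_of_sub_mem h4,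
    ← Pi.single_add, add_neg_cancel, Pi.single_zero] at h3
  simp only [Pi.single_eq_same, Pi.single_eq_of_ne hij.symm, Int.cast_neg, Int.cast_natCast,
    Int.cast_zero, zero_smul, mul_zero, neg_zero, add_zero, sub_zero, map_smul,
    LinearMap.smul_apply, h.right, smul_smul] at h3
  have hr' : (r : ℂ) ≠ 0 := by exact_mod_cast hr.ne'
  exact smul_ne_zero (mul_ne_zero (neg_ne_zero.mpr hr') hb) h.ne_zero h3.symm

lemma exists_jointEigen (hρ : IsCuspidalRep ρ W N)
    (hτ : IsFullToroidal n 𝔤 τ κ c₁ c₂ E K W) (i j : Fin n) (p : B) :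
    ∃ l a b v, JointEigen ρ W i j p l a b v := by
  obtain ⟨l, hl⟩ := hρ.exists_wt_ne_bot
  have hW : ∀ i, W 0 i ∈ gradedPiece E K W 0 := W_mem_gradedPiece 0
  obtain ⟨a, v, hv, hv0, ha⟩ := hρ.exists_eigenvector le_rfl hl
    fun v hv => hρ.apply_mem_wt_self hτ (hW i) p hv
  obtain ⟨b, w, hw, hw0, hb⟩ := hρ.exists_eigenvector (l := l)
    (U := wt ρ W l ⊓ LinearMap.ker (ρ p (W 0 i) - algebraMap ℂ (Module.End ℂ V) a))
    inf_le_left (f := ρ p (W 0 j))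
    (fun h => hv0 ((Submodule.mem_bot ℂ).mp (h ▸ ⟨hv, by
      rw [SetLike.mem_coe, LinearMap.mem_ker, LinearMap.sub_apply, ha,
        Module.algebraMap_end_apply, sub_self]⟩)))
    (fun v hv => ⟨hρ.apply_mem_wt_self hτ (hW j) p hv.1, by
      have h := LinearMap.mem_ker.mp hv.2
      rw [LinearMap.sub_apply, Module.algebraMap_end_apply, sub_eq_zero] at h
      rw [SetLike.mem_coe, LinearMap.mem_ker, LinearMap.sub_apply, Module.algebraMap_end_apply,
        hρ.degree_apply hτ (hW j), h, map_smul]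
      simp⟩)
  have h := LinearMap.mem_ker.mp hw.2
  rw [LinearMap.sub_apply, Module.algebraMap_end_apply, sub_eq_zero] at h
  exact ⟨l, a, b, w, hw.1, hw0, h, hb⟩

lemma exists_jointEigen_ne_zero (hρ : IsCuspidalRep ρ W N)
    (hτ : IsFullToroidal n 𝔤 τ κ c₁ c₂ E K W) (hn : 2 ≤ n)
    (i j : Fin n) {p q : B} (hpq : p + q = 1) (hA : p * q ∈ annIdeal ρ)
    (hp : p ∉ annIdeal ρ) (hq : q ∉ annIdeal ρ) :
    ∃ l a b v, JointEigen ρ W i j p l a b v ∧ b ≠ 0 ∧ l j - b ≠ 0 := by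
  have hpq' : q + p = 1 := by rw [add_comm, hpq]
  have hA' : q * p ∈ annIdeal ρ := by rwa [mul_comm]
  obtain ⟨l, a, b, v, h, hb⟩ : ∃ l a b v, JointEigen ρ W i j p l a b v ∧ b ≠ 0 := by
    obtain ⟨l, a, b, v, h⟩ := hρ.exists_jointEigen hτ i j p
    by_cases hb : b = 0
    · obtain ⟨m, hm, Y, hY, c, hc⟩ := hρ.exists_apply_ne_zero hτ hn j hpq hA hp h.ne_zero
      refine ⟨_, _, _, _, hρ.jointEigen_apply_same hτ hpq hA h hY c hc, ?_⟩
      rw [hb, zero_add]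
      exact_mod_cast hm
    · exact ⟨l, a, b, v, h, hb⟩
  by_cases hlb : l j - b = 0
  · obtain ⟨m, hm, Y, hY, c, hc⟩ := hρ.exists_apply_ne_zero hτ hn j hpq' hA' hq h.ne_zero
    refine ⟨_, _, _, _, hρ.jointEigen_apply_other hτ hA h hY c hc, hb, ?_⟩
    rw [Pi.add_apply, add_sub_right_comm, hlb, zero_add]
    exact_mod_cast hm
  · exact ⟨l, a, b, v, h, hb, hlb⟩

lemma card_le_of_eigenvectors (hρ : IsCuspidalRep ρ W N)
    {ι : Type*} [Fintype ι] {l : Fin n → ℂ} {f : Module.End ℂ V}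
    {μ : ι → ℂ} (hμ : Function.Injective μ) {w : ι → V} (hw : ∀ s, w s ∈ wt ρ W l)
    (hw0 : ∀ s, w s ≠ 0) (hf : ∀ s, f (w s) = μ s • w s) : Fintype.card ι ≤ N := by
  have := hρ.finite_wt l
  have hli : LinearIndependent ℂ w := Module.End.eigenvectors_linearIndependent' f μ hμ w
    fun s => ⟨Module.End.mem_eigenspace_iff.mpr (hf s), hw0 s⟩
  have hli' : LinearIndependent ℂ fun s => (⟨w s, hw s⟩ : wt ρ W l) :=
    LinearIndependent.of_comp (wt ρ W l).subtype hli
  exact hli'.fintype_card_le_finrank.trans (hρ.finrank_wt_le l)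

lemma not_forall_exists_eigenvector (hρ : IsCuspidalRep ρ W N)
    {l : Fin n → ℂ} {i : Fin n} {a : ℂ} {f : Module.End ℂ V}
    (h : ∀ r r' : ℕ, 0 < r → 0 < r' → ∃ z z' : ℤ, z.natAbs = r ∧ z'.natAbs = r' ∧
      ∃ w ∈ wt ρ W (l + fun k => ((Pi.single i (z + z') : Fin n → ℤ) k : ℂ)), w ≠ 0 ∧
        f w = (a + z) • w) : False := by
  have h' : ∀ s : ℕ × ℕ, ∃ (z z' : ℤ) (w : V), 0 < s.1 → 0 < s.2 →
      z.natAbs = s.1 ∧ z'.natAbs = s.2 ∧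
      w ∈ wt ρ W (l + fun k => ((Pi.single i (z + z') : Fin n → ℤ) k : ℂ)) ∧ w ≠ 0 ∧
        f w = (a + z) • w := by
    intro s
    by_cases hs : 0 < s.1 ∧ 0 < s.2
    · obtain ⟨z, z', h1, h2, w, h3⟩ := h s.1 s.2 hs.1 hs.2
      exact ⟨z, z', w, fun _ _ => ⟨h1, h2, h3⟩⟩
    · exact ⟨0, 0, 0, fun h1 h2 => absurd ⟨h1, h2⟩ hs⟩
  choose z z' w hw using h'
  set M := 5 * N + 5 with hM
  obtain ⟨k, -, hk⟩ := Finset.exists_lt_card_fiber_of_mul_lt_card_of_maps_to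
    (s := Finset.Icc 1 M ×ˢ Finset.Icc 1 M) (t := Finset.Icc (-(2 * M : ℤ)) (2 * M))
    (f := fun s => z s + z' s) (n := N) (by
      intro s hs
      simp only [Finset.mem_product, Finset.mem_Icc] at hs
      obtain ⟨h1, h2, -⟩ := hw s (by omega) (by omega)
      simp only [Finset.mem_Icc]
      omega) (by
      rw [Finset.card_product, Nat.card_Icc, Int.card_Icc]
      have : (2 * (M : ℤ) + 1 - -(2 * M)).toNat = 4 * M + 1 := by omega
      rw [this, add_tsub_cancel_right]
      nlinarith)
  set T := (Finset.Icc 1 M ×ˢ Finset.Icc 1 M).filter fun s => z s + z' s = k with hT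
  have hmem : ∀ s : T, 0 < s.1.1 ∧ 0 < s.1.2 ∧ z s + z' s = k := by
    intro s
    have := s.2
    simp only [hT, Finset.mem_filter, Finset.mem_product, Finset.mem_Icc] at this
    exact ⟨by omega, by omega, this.2⟩
  have hw' := fun s : T => hw s (hmem s).1 (hmem s).2.1
  have hcard := hρ.card_le_of_eigenvectors (ι := T) (f := f)
    (l := l + fun j => ((Pi.single i k : Fin n → ℤ) j : ℂ))
    (μ := fun s => a + z s) (w := fun s => w s) (fun s t hst => by
      have hz : z s = z t := by exact_mod_cast add_left_cancel hst
      have hz' : z' s = z' t := by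
        have := (hmem s).2.2
        have := (hmem t).2.2
        omega
      refine Subtype.ext (Prod.ext ?_ ?_)
      · rw [← (hw' s).1, ← (hw' t).1, hz]
      · rw [← (hw' s).2.1, ← (hw' t).2.1, hz'])
    (fun s => (hmem s).2.2 ▸ (hw' s).2.2.1) (fun s => (hw' s).2.2.2.1)
    (fun s => (hw' s).2.2.2.2)
  rw [Fintype.card_coe] at hcard
  omega

lemma mem_annIdeal_or_mem_of_idempotent (hρ : IsCuspidalRep ρ W N)
    (hτ : IsFullToroidal n 𝔤 τ κ c₁ c₂ E K W) (hn : 2 ≤ n)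
    {p q : B} (hpq : p + q = 1) (hA : p * q ∈ annIdeal ρ) :
    p ∈ annIdeal ρ ∨ q ∈ annIdeal ρ := by
  by_contra! hcon
  let i : Fin n := ⟨0, by omega⟩
  let j : Fin n := ⟨1, by omega⟩
  have hij : i ≠ j := by simp [i, j]
  have hpq' : q + p = 1 := by rw [add_comm, hpq]
  have hA' : q * p ∈ annIdeal ρ := by rwa [mul_comm]
  obtain ⟨l, a, b, v, h, hb, hlb⟩ :=
    hρ.exists_jointEigen_ne_zero hτ hn i j hpq hA hcon.1 hcon.2
  refine hρ.not_forall_exists_eigenvector (l := l) (i := i) (a := a) (f := ρ p (W 0 i))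
    fun r r' hr hr' => ?_
  obtain ⟨z, hz, Y, hY, h0⟩ :=
    hρ.exists_apply_ne_zero_of_eigenvalue_ne_zero hτ hij hpq hA h hb hr
  have h1 := hρ.jointEigen_apply_same hτ hpq hA h hY 1 (by rwa [one_mul])
  obtain ⟨z', hz', Y', hY', h0'⟩ :=
    hρ.exists_apply_ne_zero_of_eigenvalue_ne_zero hτ hij hpq' hA' (h1.compl hpq)
      (by simpa [Pi.single_eq_of_ne hij.symm] using hlb) hr'
  have h2 := hρ.jointEigen_apply_other hτ hA h1 hY' 1 (by rwa [one_mul])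
  refine ⟨z, z', hz, hz', _, ?_, h2.ne_zero, ?_⟩
  · convert h2.mem_wt using 1
    congr 1
    ext k
    simp [Pi.single_add, add_assoc]
  · simpa using h2.left

end IsCuspidalRep

end Idempotent

/-- In an Artinian ring, `a ^ k` is a multiple of `a ^ (k + 1)` for some `k`. -/
lemma exists_pow_mul_one_sub_mul_eq_zero {R : Type*} [CommRing R] [IsArtinianRing R] (a : R) :
    ∃ k, ∃ c : R, a ^ k * (1 - a * c) = 0 := by
  obtain ⟨k, c, hc⟩ := IsArtinian.exists_pow_succ_smul_dvd a (1 : R)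
  refine ⟨k, c, ?_⟩
  rw [smul_eq_mul, smul_eq_mul, mul_one] at hc
  rw [mul_sub, mul_one, ← mul_assoc, ← pow_succ, hc, sub_self]

/-- The maximal ideals of a finitely generated algebra are the kernels of its characters. -/
lemma exists_algHom_ker_eq {B : Type} [CommRing B] [Algebra ℂ B] (hB : Algebra.FiniteType ℂ B)
    (I : Ideal B) [I.IsMaximal] : ∃ ψ : B →ₐ[ℂ] ℂ, I = RingHom.ker ψ := by
  have : Module.Finite ℂ (B ⧸ I) := by
    let _ := Ideal.Quotient.field I
    exact finite_of_finite_type_of_isJacobsonRing ℂ (B ⧸ I)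
  have hbij : Function.Bijective (algebraMap ℂ (B ⧸ I)) :=
    IsAlgClosed.algebraMap_bijective_of_isIntegral
  let e : ℂ ≃ₐ[ℂ] B ⧸ I := AlgEquiv.ofBijective (Algebra.ofId ℂ (B ⧸ I)) hbij
  refine ⟨(e.symm : (B ⧸ I) →ₐ[ℂ] ℂ).comp (Ideal.Quotient.mkₐ ℂ I), ?_⟩
  ext b
  simp [RingHom.mem_ker, Ideal.Quotient.eq_zero_iff_mem]

section Main

variable {B : Type} [CommRing B] [Algebra ℂ B] {V : Type} [AddCommGroup V] [Module ℂ V]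
variable {κ : 𝔤 →ₗ[ℂ] 𝔤 →ₗ[ℂ] ℂ} {c₁ c₂ : ℂ}
  {E : (Fin n → ℤ) → 𝔤 →ₗ[ℂ] τ} {K W : (Fin n → ℤ) → Fin n → τ}

lemma IsCuspidalRep.exists_isMaximal_le_annIdeal [FiniteDimensional ℂ 𝔤] [Nontrivial B]
    {ρ : B →ₗ[ℂ] τ →ₗ[ℂ] Module.End ℂ V} {N : ℕ} (hρ : IsCuspidalRep ρ W N)
    (hτ : IsFullToroidal n 𝔤 τ κ c₁ c₂ E K W) (hn : 2 ≤ n) (hB : Algebra.FiniteType ℂ B) :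
    ∃ I : Ideal B, I.IsMaximal ∧ I ≤ annIdeal ρ := by
  have hart := hρ.isArtinianRing_quotient_annIdeal hτ hn hB
  have hfin : Module.Finite ℂ (B ⧸ annIdeal ρ) :=
    Module.finite_of_isArtinianRing ℂ (B ⧸ annIdeal ρ)
  have hrad : (annIdeal ρ).IsRadical :=
    (Ideal.isRadical_iff_pow_one_lt 2 one_lt_two).mpr fun r hr =>
      hρ.mem_annIdeal_of_sq_mem hτ hn hfin (by rwa [← pow_two])
  by_cases htop : annIdeal ρ = ⊤
  · obtain ⟨I, hI⟩ := Ideal.exists_maximal B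
    exact ⟨I, hI, htop ▸ le_top⟩
  refine ⟨annIdeal ρ, Ideal.isMaximal_iff.mpr ⟨fun h => htop ((Ideal.eq_top_iff_one _).mpr h),
    fun J a hJ ha haJ => ?_⟩, le_rfl⟩
  obtain ⟨k, c, hc⟩ := exists_pow_mul_one_sub_mul_eq_zero (Ideal.Quotient.mk (annIdeal ρ) a)
  obtain ⟨c, rfl⟩ := Ideal.Quotient.mk_surjective c
  rw [← map_pow, ← map_mul, ← map_one (Ideal.Quotient.mk (annIdeal ρ)), ← map_sub, ← map_mul,
    Ideal.Quotient.eq_zero_iff_mem] at hc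
  have h1 : a * (1 - a * c) ∈ annIdeal ρ := by
    refine hrad ⟨k + 1, ?_⟩
    have : (a * (1 - a * c)) ^ (k + 1) = a ^ k * (1 - a * c) * (a * (1 - a * c) ^ k) := by
      rw [mul_pow]; ring
    rw [this]
    exact Ideal.mul_mem_right _ _ hc
  rcases hρ.mem_annIdeal_or_mem_of_idempotent hτ hn (p := a * c) (q := 1 - a * c) (by ring)
    (by rw [mul_right_comm]; exact Ideal.mul_mem_right _ _ h1) with h | h
  · refine absurd ?_ ha
    have : a = a * (1 - a * c) + a * (a * c) := by ring
    rw [this]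
    exact Ideal.add_mem _ h1 (Ideal.mul_mem_left _ _ h)
  · have : (1 : B) = (1 - a * c) + a * c := by ring
    rw [this]
    exact J.add_mem (hJ h) (J.mul_mem_right _ haJ)

variable [LieRingModule (B ⊗[ℂ] τ) V] [LieModule ℂ (B ⊗[ℂ] τ) V]

variable (B τ V) in
/-- The action of `τ(B)` on a module, as a bilinear map. -/
noncomputable def mapAction : B →ₗ[ℂ] τ →ₗ[ℂ] Module.End ℂ V :=
  LinearMap.compr₂ (TensorProduct.mk ℂ B τ)
    (LieModule.toEnd ℂ (B ⊗[ℂ] τ) V : B ⊗[ℂ] τ →ₗ[ℂ] Module.End ℂ V)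

lemma mapAction_apply (b : B) (X : τ) (v : V) : mapAction τ B V b X v = ⁅b ⊗ₜ[ℂ] X, v⁆ := rfl

lemma exists_isCuspidalRep_mapAction (hirr : LieModule.IsIrreducible ℂ (B ⊗[ℂ] τ) V)
    (hcusp : IsCuspidal (V := V) (dOp B W)) : ∃ N, IsCuspidalRep (mapAction τ B V) W N := by
  obtain ⟨⟨htop, hfin⟩, N, hN⟩ := hcusp
  refine ⟨N, ?_, ?_, ?_, htop, hfin, hN⟩
  · intro a b X Y v
    simp only [mapAction_apply]
    rw [← LieAlgebra.ExtendScalars.bracket_tmul, lie_lie]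
    abel
  · exact LieModule.nontrivial_of_isIrreducible ℂ (B ⊗[ℂ] τ) V
  · intro U hU
    let U' : LieSubmodule ℂ (B ⊗[ℂ] τ) V :=
      { U with
        lie_mem := by
          intro x v hv
          induction x using TensorProduct.induction_on with
          | zero => rw [zero_lie]; exact U.zero_mem
          | tmul b X => exact hU b X v hv
          | add x y hx hy => rw [add_lie]; exact U.add_mem hx hy }
    rcases hirr.eq_bot_or_eq_top U' with h | h
    · exact Or.inl (by simpa [U'] using congrArg LieSubmodule.toSubmodule h)
    · exact Or.inr (by simpa [U'] using congrArg LieSubmodule.toSubmodule h)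

end Main

theorem statement_1
    (n : ℕ) (hn : 3 ≤ n)
    (𝔤 : Type) [LieRing 𝔤] [LieAlgebra ℂ 𝔤] [LieAlgebra.IsSimple ℂ 𝔤]
    [FiniteDimensional ℂ 𝔤]
    (τ : Type) [LieRing τ] [LieAlgebra ℂ τ]
    (κ : 𝔤 →ₗ[ℂ] 𝔤 →ₗ[ℂ] ℂ) (c₁ c₂ : ℂ)
    (E : (Fin n → ℤ) → 𝔤 →ₗ[ℂ] τ) (K W : (Fin n → ℤ) → Fin n → τ)
    (hτ : IsFullToroidal n 𝔤 τ κ c₁ c₂ E K W)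
    (B : Type) [CommRing B] [Algebra ℂ B] [Nontrivial B]
    (hB : Algebra.FiniteType ℂ B)
    (V : Type) [AddCommGroup V] [Module ℂ V]
    [LieRingModule (B ⊗[ℂ] τ) V] [LieModule ℂ (B ⊗[ℂ] τ) V]
    (hirr : LieModule.IsIrreducible ℂ (B ⊗[ℂ] τ) V)
    (hcusp : IsCuspidal (V := V) (dOp B W))
 :
    ∃ (𝔐 : Ideal B) (ψ : B →ₐ[ℂ] ℂ), 𝔐.IsMaximal ∧ 𝔐 = RingHom.ker ψ ∧
      annTensor τ B 𝔐 V ∧ evalActs τ B ψ V := by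
  obtain ⟨N, hρ⟩ := exists_isCuspidalRep_mapAction hirr hcusp
  obtain ⟨𝔐, h𝔐, hle⟩ := hρ.exists_isMaximal_le_annIdeal hτ (by omega) hB
  obtain ⟨ψ, hψ⟩ := exists_algHom_ker_eq hB 𝔐
  have hann : annTensor τ B 𝔐 V := fun X a ha v => by
    rw [← mapAction_apply]
    have := hle ha 1 X
    rw [one_mul] at this
    rw [this, LinearMap.zero_apply]
  refine ⟨𝔐, ψ, h𝔐, hψ, hann, fun X b v => ?_⟩
  have hmem : b - algebraMap ℂ B (ψ b) ∈ 𝔐 := by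
    rw [hψ, RingHom.mem_ker, map_sub, AlgHom.commutes, Algebra.algebraMap_self_apply, sub_self]
  have h := hann X _ hmem v
  rwa [TensorProduct.sub_tmul, sub_lie, sub_eq_zero, Algebra.algebraMap_eq_smul_one,
    ← TensorProduct.smul_tmul', smul_lie] at h

end MT
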